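/- arXiv:1705.07411 — 5 statements merged into one kernel-verified Lean document; each statement's English description precedes it below -/
import Mathlib

section
/- Work in the polynomial ring $\mathbb{R}[p_{i_1 i_2 i_3} : i_1, i_2, i_3 \in \{1,2\}]$ in eight indeterminates. Let $I_{\mathcal{C}} = \langle p_{111}p_{212} - p_{112}p_{211},\ p_{121}p_{222} - p_{122}p_{221},\ (p_{111} + p_{121})(p_{212} + p_{222}) - (p_{112} + p_{122})(p_{211} + p_{221}) \rangle$, let $I_{\{1,2\} \perp 3}$ be the ideal generated by all binomials $p_{i_1 i_2 i_3} p_{j_1 j_2 j_3} - p_{i_1 i_2 j_3} p_{j_1 j_2 i_3}$, and let $I_{1 \perp \{2,3\}}$ be the ideal generated by all binomials $p_{i_1 i_2 i_3} p_{j_1 j_2 j_3} - p_{i_1 j_2 j_3} p_{j_1 i_2 i_3}$. Then $I_{\mathcal{C}} = I_{\{1,2\} \perp 3} \cap I_{1 \perp \{2,3\}}$. -/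
open MvPolynomial

/-- The indeterminate `p_{i₁ i₂ i₃}` of the polynomial ring
`ℝ[p_{i₁i₂i₃} : i₁,i₂,i₃ ∈ {1,2}]`. -/
noncomputable def pVar (i₁ i₂ i₃ : Fin 2) : MvPolynomial (Fin 2 × Fin 2 × Fin 2) ℝ :=
  X (i₁, i₂, i₃)

section Segre

variable {ι κ R : Type*} [CommRing R]

/-- The ideal generated by the `2 × 2` minors of the generic matrix with entries `X (i, k)`. -/
noncomputable def segreIdeal (ι κ R : Type*) [CommRing R] : Ideal (MvPolynomial (ι × κ) R) :=
  Ideal.span {f | ∃ i k j l, f = X (i, k) * X (j, l) - X (i, l) * X (j, k)}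

/-- The parametrization of rank one matrices. -/
noncomputable def segreMap (ι κ R : Type*) [CommRing R] :
    MvPolynomial (ι × κ) R →ₐ[R] MvPolynomial (ι ⊕ κ) R :=
  aeval fun q => X (Sum.inl q.1) * X (Sum.inr q.2)

lemma prod_X_sub_prod_X_mem_segreIdeal (s t : Multiset (ι × κ))
    (hfst : s.map Prod.fst = t.map Prod.fst) (hsnd : s.map Prod.snd = t.map Prod.snd) :
    (s.map X).prod - (t.map X).prod ∈ segreIdeal ι κ R := by
  induction s using Multiset.induction generalizing t with
  | empty =>
    obtain rfl : t = 0 := by simpa using hfst.symm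
    simp
  | cons q s ih =>
    obtain ⟨i, k⟩ := q
    have hi : i ∈ t.map Prod.fst := hfst ▸ by simp
    have hk : k ∈ t.map Prod.snd := hsnd ▸ by simp
    obtain ⟨⟨i', l⟩, hil, rfl⟩ := Multiset.mem_map.1 hi
    obtain ⟨⟨j, k'⟩, hjk, rfl⟩ := Multiset.mem_map.1 hk
    obtain ⟨t, rfl⟩ := Multiset.exists_cons_of_mem hil
    rcases Multiset.mem_cons.1 hjk with h | h
    · obtain ⟨rfl, rfl⟩ := Prod.mk.inj h
      have := ih t (by simpa using hfst) (by simpa using hsnd)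
      simpa [← mul_sub] using Ideal.mul_mem_left _ (X (j, k')) this
    · obtain ⟨r, rfl⟩ := Multiset.exists_cons_of_mem h
      have hrec := ih ((j, l) ::ₘ r) (by simpa using hfst) (by
        simp only [Multiset.map_cons] at hsnd ⊢
        rw [Multiset.cons_swap] at hsnd
        simpa using hsnd)
      have hminor : X (i', k') * X (j, l) - X (i', l) * X (j, k') ∈ segreIdeal ι κ R :=
        Ideal.subset_span ⟨_, _, _, _, rfl⟩
      convert Ideal.add_mem _ (Ideal.mul_mem_left _ (X (i', k')) hrec)
        (Ideal.mul_mem_left _ (r.map X).prod hminor) using 1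
      simp only [Multiset.map_cons, Multiset.prod_cons]
      ring

/-- The exponent of the image of a monomial under `segreMap`. -/
noncomputable def segreExponent (m : ι × κ →₀ ℕ) : ι ⊕ κ →₀ ℕ :=
  m.mapDomain (Sum.inl ∘ Prod.fst) + m.mapDomain (Sum.inr ∘ Prod.snd)

lemma segreMap_monomial (m : ι × κ →₀ ℕ) (c : R) :
    segreMap ι κ R (monomial m c) = monomial (segreExponent m) c := by
  rw [segreMap, aeval_monomial, monomial_eq, algebraMap_eq, segreExponent,
    Finsupp.prod_add_index' (by simp) (by simp [pow_add]),
    Finsupp.prod_mapDomain_index (by simp) (by simp [pow_add]),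
    Finsupp.prod_mapDomain_index (by simp) (by simp [pow_add]), ← Finsupp.prod_mul]
  simp only [mul_pow, Function.comp_apply]

lemma monomial_sub_monomial_mem_segreIdeal {m n : ι × κ →₀ ℕ}
    (h : segreExponent m = segreExponent n) :
    monomial m 1 - monomial n 1 ∈ segreIdeal ι κ R := by
  have hfst : m.mapDomain Prod.fst = n.mapDomain Prod.fst := by
    ext i
    have := DFunLike.congr_fun h (Sum.inl i)
    simpa [segreExponent, Finsupp.mapDomain_comp, Finsupp.mapDomain_apply Sum.inl_injective,
      Finsupp.mapDomain_of_notMem_range] using this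
  have hsnd : m.mapDomain Prod.snd = n.mapDomain Prod.snd := by
    ext k
    have := DFunLike.congr_fun h (Sum.inr k)
    simpa [segreExponent, Finsupp.mapDomain_comp, Finsupp.mapDomain_apply Sum.inr_injective,
      Finsupp.mapDomain_of_notMem_range] using this
  have hprod (m : ι × κ →₀ ℕ) :
      (monomial m 1 : MvPolynomial (ι × κ) R) = (m.toMultiset.map X).prod := by
    rw [Finsupp.toMultiset_map, Finsupp.prod_toMultiset,
      Finsupp.prod_mapDomain_index (by simp) (by simp [pow_add]), monomial_eq, C_1, one_mul]
  rw [hprod, hprod]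
  exact prod_X_sub_prod_X_mem_segreIdeal _ _
    (by rw [Finsupp.toMultiset_map, Finsupp.toMultiset_map, hfst])
    (by rw [Finsupp.toMultiset_map, Finsupp.toMultiset_map, hsnd])

lemma mem_segreIdeal_of_segreMap_eq_zero {f : MvPolynomial (ι × κ) R}
    (hf : segreMap ι κ R f = 0) : f ∈ segreIdeal ι κ R := by
  classical
  let mk := (Ideal.Quotient.mkₐ R (segreIdeal ι κ R)).toLinearMap
  let L := (basisMonomials (ι ⊕ κ) R).constr R fun n =>
    mk (monomial (Function.invFun segreExponent n) 1)
  have hL : L ∘ₗ (segreMap ι κ R).toLinearMap = mk := by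
    refine (basisMonomials (ι × κ) R).ext fun m => ?_
    have h1 : segreMap ι κ R (basisMonomials (ι × κ) R m) =
        basisMonomials (ι ⊕ κ) R (segreExponent m) := by
      simp [segreMap_monomial]
    have h2 : segreExponent (Function.invFun segreExponent (segreExponent m)) =
        segreExponent m := Function.invFun_eq ⟨m, rfl⟩
    rw [LinearMap.comp_apply, AlgHom.toLinearMap_apply, h1, Module.Basis.constr_basis,
      coe_basisMonomials]
    exact Ideal.Quotient.eq.2 (monomial_sub_monomial_mem_segreIdeal h2)
  have := LinearMap.congr_fun hL f
  rw [LinearMap.comp_apply, AlgHom.toLinearMap_apply, hf, map_zero] at this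
  exact Ideal.Quotient.eq_zero_iff_mem.1 this.symm

end Segre

/-- The substitution setting the variables satisfying `P` to zero. -/
noncomputable def killVars {σ : Type*} (R : Type*) [CommRing R] (P : σ → Prop) [DecidablePred P] :
    MvPolynomial σ R →ₐ[R] MvPolynomial σ R :=
  aeval fun q => if P q then 0 else X q

lemma mem_of_killVars_eq_zero {σ R : Type*} [CommRing R] {P : σ → Prop} [DecidablePred P]
    {I : Ideal (MvPolynomial σ R)} (hI : ∀ q, P q → X q ∈ I) {f : MvPolynomial σ R}
    (hf : killVars R P f = 0) : f ∈ I := by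
  have h : (Ideal.Quotient.mkₐ R I).comp (killVars R P) = Ideal.Quotient.mkₐ R I := by
    refine algHom_ext fun q => ?_
    by_cases hq : P q
    · simpa [killVars, hq] using (Ideal.Quotient.eq_zero_iff_mem.2 (hI q hq)).symm
    · simp [killVars, hq]
  have := DFunLike.congr_fun h f
  rw [AlgHom.comp_apply, hf, map_zero] at this
  exact Ideal.Quotient.eq_zero_iff_mem.1 this.symm

/-- The minor of the `4 × 2` flattening with rows `(i₁, i₂)` and `(j₁, j₂)`. -/
def bracket {S : Type*} [CommRing S] (p : Fin 2 → Fin 2 → Fin 2 → S) (i₁ i₂ j₁ j₂ : Fin 2) : S :=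
  p i₁ i₂ 0 * p j₁ j₂ 1 - p i₁ i₂ 1 * p j₁ j₂ 0

/-- The generators of the ideal `I_𝒞` vanish at `p`. -/
def IsCIPoint {S : Type*} [CommRing S] (p : Fin 2 → Fin 2 → Fin 2 → S) : Prop :=
  bracket p 0 0 1 0 = 0 ∧ bracket p 0 1 1 1 = 0 ∧ bracket p 0 0 1 1 + bracket p 0 1 1 0 = 0

namespace IsCIPoint

variable {S : Type*} [CommRing S] {p : Fin 2 → Fin 2 → Fin 2 → S}

lemma map (hp : IsCIPoint p) {T : Type*} [CommRing T] (φ : S →+* T) :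
    IsCIPoint fun i j k => φ (p i j k) := by
  obtain ⟨h1, h2, h3⟩ := hp
  refine ⟨?_, ?_, ?_⟩
  · simpa [bracket] using congrArg φ h1
  · simpa [bracket] using congrArg φ h2
  · simpa [bracket] using congrArg φ h3

lemma segre_minor_mul_bracket (hp : IsCIPoint p) (i₁ i₂ i₃ j₁ j₂ j₃ : Fin 2) :
    (p i₁ i₂ i₃ * p j₁ j₂ j₃ - p i₁ j₂ j₃ * p j₁ i₂ i₃) * bracket p 0 0 1 1 = 0 := by
  obtain ⟨h1, h2, h3⟩ := hp
  simp only [bracket] at *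
  fin_cases i₁ <;> fin_cases j₁ <;> fin_cases i₂ <;> fin_cases j₂ <;> fin_cases i₃ <;>
    fin_cases j₃ <;> simp only [Fin.mk_one, Fin.zero_eta] <;> grind

lemma pair_minor_eq_zero (hp : IsCIPoint p) (h₁ : bracket p 0 0 1 1 = 0)
    (h₂ : bracket p 0 0 0 1 = 0) (h₃ : bracket p 1 0 1 1 = 0) (i₁ i₂ i₃ j₁ j₂ j₃ : Fin 2) :
    p i₁ i₂ i₃ * p j₁ j₂ j₃ - p i₁ i₂ j₃ * p j₁ j₂ i₃ = 0 := by
  obtain ⟨h4, h5, h6⟩ := hp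
  simp only [bracket] at *
  fin_cases i₁ <;> fin_cases j₁ <;> fin_cases i₂ <;> fin_cases j₂ <;> fin_cases i₃ <;>
    fin_cases j₃ <;> simp only [Fin.mk_one, Fin.zero_eta] <;> grind

lemma row_one_mul_bracket (hp : IsCIPoint p) (i k : Fin 2) :
    p 1 i k * bracket p 0 0 0 1 = p 0 i k * bracket p 0 0 1 1 := by
  obtain ⟨h1, h2, h3⟩ := hp
  simp only [bracket] at *
  fin_cases i <;> fin_cases k <;> simp only [Fin.mk_one, Fin.zero_eta] <;> grind

lemma row_zero_mul_bracket (hp : IsCIPoint p) (i k : Fin 2) :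
    p 0 i k * bracket p 1 0 1 1 = p 1 i k * bracket p 0 0 1 1 := by
  obtain ⟨h1, h2, h3⟩ := hp
  simp only [bracket] at *
  fin_cases i <;> fin_cases k <;> simp only [Fin.mk_one, Fin.zero_eta] <;> grind

end IsCIPoint

/-- The ideal `I_𝒞`. -/
noncomputable def ciIdeal : Ideal (MvPolynomial (Fin 2 × Fin 2 × Fin 2) ℝ) :=
  Ideal.span {bracket pVar 0 0 1 0, bracket pVar 0 1 1 1,
    (pVar 0 0 0 + pVar 0 1 0) * (pVar 1 0 1 + pVar 1 1 1)
      - (pVar 0 0 1 + pVar 0 1 1) * (pVar 1 0 0 + pVar 1 1 0)}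

/-- The ideal `I_{{1,2} ⟂ 3}`. -/
noncomputable def pairIndepIdeal : Ideal (MvPolynomial (Fin 2 × Fin 2 × Fin 2) ℝ) :=
  Ideal.span {f | ∃ i₁ i₂ i₃ j₁ j₂ j₃ : Fin 2,
    f = pVar i₁ i₂ i₃ * pVar j₁ j₂ j₃ - pVar i₁ i₂ j₃ * pVar j₁ j₂ i₃}

lemma isCIPoint_mk : IsCIPoint fun i j k => Ideal.Quotient.mk ciIdeal (pVar i j k) := by
  have h1 : Ideal.Quotient.mk ciIdeal (bracket pVar 0 0 1 0) = 0 :=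
    Ideal.Quotient.eq_zero_iff_mem.2 (Ideal.subset_span (by simp))
  have h2 : Ideal.Quotient.mk ciIdeal (bracket pVar 0 1 1 1) = 0 :=
    Ideal.Quotient.eq_zero_iff_mem.2 (Ideal.subset_span (by simp))
  have h3 : Ideal.Quotient.mk ciIdeal ((pVar 0 0 0 + pVar 0 1 0) * (pVar 1 0 1 + pVar 1 1 1)
      - (pVar 0 0 1 + pVar 0 1 1) * (pVar 1 0 0 + pVar 1 1 0)) = 0 :=
    Ideal.Quotient.eq_zero_iff_mem.2 (Ideal.subset_span (by simp))
  simp only [bracket, map_sub, map_mul, map_add] at h1 h2 h3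
  refine ⟨h1, h2, ?_⟩
  simp only [bracket]
  linear_combination h3 - h1 - h2

lemma mk_bracket (I : Ideal (MvPolynomial (Fin 2 × Fin 2 × Fin 2) ℝ)) (i₁ i₂ j₁ j₂ : Fin 2) :
    Ideal.Quotient.mk I (bracket pVar i₁ i₂ j₁ j₂) =
      bracket (fun i j k => Ideal.Quotient.mk I (pVar i j k)) i₁ i₂ j₁ j₂ := by
  simp [bracket]

lemma ciIdeal_le_pairIndepIdeal : ciIdeal ≤ pairIndepIdeal := by
  have h (i₁ i₂ j₁ j₂ : Fin 2) : bracket pVar i₁ i₂ j₁ j₂ ∈ pairIndepIdeal :=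
    Ideal.subset_span ⟨_, _, _, _, _, _, rfl⟩
  refine Ideal.span_le.2 ?_
  rintro _ (rfl | rfl | rfl)
  · exact h 0 0 1 0
  · exact h 0 1 1 1
  · rw [SetLike.mem_coe]
    convert add_mem (add_mem (h 0 0 1 0) (h 0 0 1 1)) (add_mem (h 0 1 1 0) (h 0 1 1 1)) using 1
    simp only [bracket]
    ring

lemma ciIdeal_le_segreIdeal : ciIdeal ≤ segreIdeal (Fin 2) (Fin 2 × Fin 2) ℝ := by
  have h (i j k l : Fin 2) :
      pVar 0 i j * pVar 1 k l - pVar 0 k l * pVar 1 i j ∈ segreIdeal (Fin 2) (Fin 2 × Fin 2) ℝ :=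
    Ideal.subset_span ⟨_, _, _, _, rfl⟩
  refine Ideal.span_le.2 ?_
  rintro _ (rfl | rfl | rfl)
  · exact h 0 0 0 1
  · exact h 1 0 1 1
  · rw [SetLike.mem_coe]
    convert add_mem (add_mem (h 0 0 0 1) (h 0 0 1 1)) (add_mem (h 1 0 0 1) (h 1 0 1 1)) using 1
    ring

lemma pairIndepIdeal_le :
    pairIndepIdeal ≤ ciIdeal ⊔ Ideal.span
      {bracket pVar 0 0 1 1, bracket pVar 0 0 0 1, bracket pVar 1 0 1 1} := by
  set K := ciIdeal ⊔ Ideal.span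
      {bracket pVar 0 0 1 1, bracket pVar 0 0 0 1, bracket pVar 1 0 1 1}
  have hC : ciIdeal ≤ K := le_sup_left
  have hS {f} (hf : f ∈ ({bracket pVar 0 0 1 1, bracket pVar 0 0 0 1, bracket pVar 1 0 1 1} :
      Set (MvPolynomial (Fin 2 × Fin 2 × Fin 2) ℝ))) : Ideal.Quotient.mk K f = 0 :=
    Ideal.Quotient.eq_zero_iff_mem.2 ((le_sup_right : _ ≤ K) (Ideal.subset_span hf))
  have h1 := hS (f := bracket pVar 0 0 1 1) (by simp)
  have h2 := hS (f := bracket pVar 0 0 0 1) (by simp)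
  have h3 := hS (f := bracket pVar 1 0 1 1) (by simp)
  rw [mk_bracket] at h1 h2 h3
  have hp : IsCIPoint fun i j k => Ideal.Quotient.mk K (pVar i j k) :=
    isCIPoint_mk.map (Ideal.Quotient.factor hC)
  refine Ideal.span_le.2 ?_
  rintro _ ⟨i₁, i₂, i₃, j₁, j₂, j₃, rfl⟩
  refine Ideal.Quotient.eq_zero_iff_mem.1 ?_
  rw [map_sub, map_mul, map_mul]
  exact hp.pair_minor_eq_zero h1 h2 h3 i₁ i₂ i₃ j₁ j₂ j₃

lemma segreIdeal_mul_bracket_mem {x : MvPolynomial (Fin 2 × Fin 2 × Fin 2) ℝ}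
    (hx : x ∈ segreIdeal (Fin 2) (Fin 2 × Fin 2) ℝ) : x * bracket pVar 0 0 1 1 ∈ ciIdeal := by
  induction hx using Submodule.span_induction with
  | mem f hf =>
    obtain ⟨i, ⟨k, k'⟩, j, ⟨l, l'⟩, rfl⟩ := hf
    rw [← Ideal.Quotient.eq_zero_iff_mem, map_mul, mk_bracket,
      ← isCIPoint_mk.segre_minor_mul_bracket i k k' j l l']
    simp [pVar]
  | zero => simp
  | add f g _ _ hf hg => simpa [add_mul] using add_mem hf hg
  | smul r f _ hf => simpa [mul_assoc] using Ideal.mul_mem_left _ r hf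

lemma pVar_one_mul_bracket_mem (i k : Fin 2) : pVar 1 i k * bracket pVar 0 0 0 1 ∈
    ciIdeal ⊔ Ideal.span {bracket pVar 0 0 1 1} := by
  have h : pVar 1 i k * bracket pVar 0 0 0 1 - pVar 0 i k * bracket pVar 0 0 1 1 ∈ ciIdeal := by
    rw [← Ideal.Quotient.eq, map_mul, map_mul, mk_bracket, mk_bracket]
    exact isCIPoint_mk.row_one_mul_bracket i k
  rw [← sub_add_cancel (pVar 1 i k * bracket pVar 0 0 0 1) (pVar 0 i k * bracket pVar 0 0 1 1)]
  exact Submodule.add_mem_sup h (Ideal.mul_mem_left _ _ (Ideal.mem_span_singleton_self _))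

lemma pVar_zero_mul_bracket_mem (i k : Fin 2) : pVar 0 i k * bracket pVar 1 0 1 1 ∈
    ciIdeal ⊔ Ideal.span {bracket pVar 0 0 1 1} := by
  have h : pVar 0 i k * bracket pVar 1 0 1 1 - pVar 1 i k * bracket pVar 0 0 1 1 ∈ ciIdeal := by
    rw [← Ideal.Quotient.eq, map_mul, map_mul, mk_bracket, mk_bracket]
    exact isCIPoint_mk.row_zero_mul_bracket i k
  rw [← sub_add_cancel (pVar 0 i k * bracket pVar 1 0 1 1) (pVar 1 i k * bracket pVar 0 0 1 1)]
  exact Submodule.add_mem_sup h (Ideal.mul_mem_left _ _ (Ideal.mem_span_singleton_self _))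

lemma killVars_eq_zero_of_mem_segreIdeal (r : Fin 2) {f : MvPolynomial (Fin 2 × Fin 2 × Fin 2) ℝ}
    (hf : f ∈ segreIdeal (Fin 2) (Fin 2 × Fin 2) ℝ) : killVars ℝ (fun q => q.1 = r) f = 0 := by
  suffices segreIdeal (Fin 2) (Fin 2 × Fin 2) ℝ ≤
      RingHom.ker (killVars ℝ fun q : Fin 2 × Fin 2 × Fin 2 => q.1 = r) from this hf
  refine Ideal.span_le.2 ?_
  rintro _ ⟨i, k, j, l, rfl⟩
  by_cases hi : i = r <;> by_cases hj : j = r <;> simp [killVars, hi, hj]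
  obtain rfl : i = j := by omega
  ring

lemma segreMap_eq_zero_of_mem_segreIdeal {ι κ R : Type*} [CommRing R]
    {f : MvPolynomial (ι × κ) R} (hf : f ∈ segreIdeal ι κ R) : segreMap ι κ R f = 0 := by
  suffices segreIdeal ι κ R ≤ RingHom.ker (segreMap ι κ R) from this hf
  refine Ideal.span_le.2 ?_
  rintro _ ⟨i, k, j, l, rfl⟩
  simp only [SetLike.mem_coe, RingHom.mem_ker, segreMap, map_sub, map_mul, aeval_X]
  ring

lemma bracket_pVar_ne_zero (r : Fin 2) : bracket pVar r 0 r 1 ≠ 0 := by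
  intro h
  have := congrArg (eval fun q => if q.2.1 = q.2.2 then (1 : ℝ) else 0) h
  simp [bracket, pVar] at this

lemma killVars_bracket {r s : Fin 2} (h : s ≠ r) :
    killVars ℝ (fun q => q.1 = r) (bracket pVar s 0 s 1) = bracket pVar s 0 s 1 := by
  simp [killVars, bracket, pVar, h]

lemma segreMap_bracket_ne_zero :
    segreMap (Fin 2) (Fin 2 × Fin 2) ℝ (bracket pVar 0 0 1 1) ≠ 0 := by
  intro h
  have := congrArg (eval (Sum.elim (fun _ => (1 : ℝ)) fun q => if q.1 = q.2 then 1 else 0)) h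
  simp [segreMap, bracket, pVar] at this

lemma killVars_bracket_cross (r : Fin 2) :
    killVars ℝ (fun q => q.1 = r) (bracket pVar 0 0 1 1) = 0 := by
  fin_cases r <;> simp [killVars, bracket, pVar]

lemma pairIndepIdeal_inf_segreIdeal_le :
    pairIndepIdeal ⊓ segreIdeal (Fin 2) (Fin 2 × Fin 2) ℝ ≤ ciIdeal := by
  rintro f ⟨hf, hf'⟩
  set K := ciIdeal ⊔ Ideal.span {bracket pVar 0 0 1 1}
  obtain ⟨e, he, g, hg, rfl⟩ := Submodule.mem_sup.1 (pairIndepIdeal_le hf)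
  obtain ⟨x, y, z, rfl⟩ := Submodule.mem_span_triple.1 hg
  simp only [smul_eq_mul] at *
  have hker := (Submodule.add_mem_iff_right _ (ciIdeal_le_segreIdeal he)).1 hf'
  have hy : y * bracket pVar 0 0 0 1 ∈ K := by
    have h0 := killVars_eq_zero_of_mem_segreIdeal 1 hker
    have hz : killVars ℝ (fun q => q.1 = 1) (bracket pVar 1 0 1 1) = 0 := by
      simp [killVars, bracket, pVar]
    rw [map_add, map_add, map_mul, map_mul, map_mul, killVars_bracket_cross, hz,
      killVars_bracket (by decide), mul_zero, mul_zero, zero_add, add_zero] at h0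
    refine Submodule.mem_colon_singleton.1 (mem_of_killVars_eq_zero (I := K.colon {_}) ?_
      ((mul_eq_zero.1 h0).resolve_right (bracket_pVar_ne_zero 0)))
    rintro ⟨_, i, k⟩ rfl
    exact Submodule.mem_colon_singleton.2 (pVar_one_mul_bracket_mem i k)
  have hz : z * bracket pVar 1 0 1 1 ∈ K := by
    have h0 := killVars_eq_zero_of_mem_segreIdeal 0 hker
    have hy : killVars ℝ (fun q => q.1 = 0) (bracket pVar 0 0 0 1) = 0 := by
      simp [killVars, bracket, pVar]
    rw [map_add, map_add, map_mul, map_mul, map_mul, killVars_bracket_cross, hy,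
      killVars_bracket (by decide), mul_zero, mul_zero, zero_add, zero_add] at h0
    refine Submodule.mem_colon_singleton.1 (mem_of_killVars_eq_zero (I := K.colon {_}) ?_
      ((mul_eq_zero.1 h0).resolve_right (bracket_pVar_ne_zero 1)))
    rintro ⟨_, i, k⟩ rfl
    exact Submodule.mem_colon_singleton.2 (pVar_zero_mul_bracket_mem i k)
  have hx : x * bracket pVar 0 0 1 1 ∈ K :=
    Ideal.mul_mem_left _ _ ((le_sup_right : _ ≤ K) (Ideal.mem_span_singleton_self _))
  obtain ⟨e', he', g, hg, hfg⟩ := Submodule.mem_sup.1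
    (add_mem ((le_sup_left : _ ≤ K) he) (add_mem (add_mem hx hy) hz))
  obtain ⟨w, rfl⟩ := Ideal.mem_span_singleton'.1 hg
  rw [← hfg] at hf' ⊢
  have hw := (Submodule.add_mem_iff_right _ (ciIdeal_le_segreIdeal he')).1 hf'
  have h0 := segreMap_eq_zero_of_mem_segreIdeal hw
  rw [map_mul] at h0
  exact add_mem he' (segreIdeal_mul_bracket_mem (mem_segreIdeal_of_segreMap_eq_zero
    ((mul_eq_zero.1 h0).resolve_right segreMap_bracket_ne_zero)))

/-- `I_𝒞 = I_{{1,2} ⟂ 3} ∩ I_{1 ⟂ {2,3}}` for three binary random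
variables, where `I_𝒞` is the CI ideal of `{1 ⟂ 3 | 2, 1 ⟂ 3}`. -/
theorem ci_ideal_decomposition_binary :
    Ideal.span {pVar 0 0 0 * pVar 1 0 1 - pVar 0 0 1 * pVar 1 0 0,
                pVar 0 1 0 * pVar 1 1 1 - pVar 0 1 1 * pVar 1 1 0,
                (pVar 0 0 0 + pVar 0 1 0) * (pVar 1 0 1 + pVar 1 1 1)
                  - (pVar 0 0 1 + pVar 0 1 1) * (pVar 1 0 0 + pVar 1 1 0)} =
      Ideal.span { f | ∃ i₁ i₂ i₃ j₁ j₂ j₃ : Fin 2,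
          f = pVar i₁ i₂ i₃ * pVar j₁ j₂ j₃ - pVar i₁ i₂ j₃ * pVar j₁ j₂ i₃ } ⊓
      Ideal.span { f | ∃ i₁ i₂ i₃ j₁ j₂ j₃ : Fin 2,
          f = pVar i₁ i₂ i₃ * pVar j₁ j₂ j₃ - pVar i₁ j₂ j₃ * pVar j₁ i₂ i₃ } := by
  have hsegre : segreIdeal (Fin 2) (Fin 2 × Fin 2) ℝ =
      Ideal.span { f | ∃ i₁ i₂ i₃ j₁ j₂ j₃ : Fin 2,
          f = pVar i₁ i₂ i₃ * pVar j₁ j₂ j₃ - pVar i₁ j₂ j₃ * pVar j₁ i₂ i₃ } := by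
    simp only [segreIdeal, pVar, Prod.exists]
  rw [← hsegre]
  exact le_antisymm (le_inf ciIdeal_le_pairIndepIdeal ciIdeal_le_segreIdeal)
    pairIndepIdeal_inf_segreIdeal_le
end

section
/- Work in the polynomial ring $\mathbb{R}[p_{i_1 i_2 i_3} : i_1, i_2, i_3 \in \{1,2\}]$. Let $I_{\mathcal{C}} = \langle p_{111}p_{221} - p_{121}p_{211},\ p_{112}p_{222} - p_{122}p_{212},\ (p_{111} + p_{211})(p_{122} + p_{222}) - (p_{112} + p_{212})(p_{121} + p_{221}) \rangle$, and let $I_{\{1,3\} \perp 2}$ be the ideal generated by all binomials $p_{i_1 i_2 i_3} p_{j_1 j_2 j_3} - p_{i_1 j_2 i_3} p_{j_1 i_2 j_3}$. Then $I_{\mathcal{C}} = I_{\{1,3\} \perp 2} \cap \langle p_{122} + p_{222},\ p_{112} + p_{212},\ p_{121}p_{211} - p_{111}p_{221} \rangle \cap \langle p_{121} + p_{221},\ p_{111} + p_{211},\ p_{122}p_{212} - p_{112}p_{222} \rangle$. -/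
open MvPolynomial

/-- An element is in the ideal generated by three elements iff it is a linear combination. -/
theorem Ideal.mem_span_triple_iff {R : Type*} [CommRing R] {u v w z : R} :
    z ∈ Ideal.span ({u, v, w} : Set R) ↔ ∃ k l m : R, k * u + l * v + m * w = z := by
  simp only [Ideal.span, Submodule.mem_span_triple, smul_eq_mul]

/-- An element of the ideal of `2 × 2` minors of four vectors `(xᵢ, yᵢ)` that lies in
`⟨x₃, y₃, [12]⟩` and in `⟨x₂, y₂, [34]⟩` lies in `⟨[12], [23], [34]⟩`. The ring endomorphisms `ρ₂`
and `ρ₃` are retractions along `(x₂, y₂)` and `(x₃, y₃)`. -/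
theorem mem_span_path_minors {R : Type*} [CommRing R] [IsDomain R]
    {x₁ y₁ x₂ y₂ x₃ y₃ x₄ y₄ g : R} (ρ₂ ρ₃ : R →+* R)
    (h₂ : ρ₂ x₂ = 0 ∧ ρ₂ y₂ = 0 ∧ ρ₂ x₁ = x₁ ∧ ρ₂ y₁ = y₁ ∧ ρ₂ x₃ = x₃ ∧ ρ₂ y₃ = y₃ ∧
      ρ₂ x₄ = x₄ ∧ ρ₂ y₄ = y₄)
    (h₃ : ρ₃ x₃ = 0 ∧ ρ₃ y₃ = 0 ∧ ρ₃ x₁ = x₁ ∧ ρ₃ y₁ = y₁ ∧ ρ₃ x₂ = x₂ ∧ ρ₃ y₂ = y₂ ∧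
      ρ₃ x₄ = x₄ ∧ ρ₃ y₄ = y₄)
    (hρ₂ : ∀ f, f - ρ₂ f ∈ Ideal.span {x₂, y₂}) (hρ₃ : ∀ f, f - ρ₃ f ∈ Ideal.span {x₃, y₃})
    (hx₁ : x₁ ≠ 0) (hx : ∀ f, x₁ ∣ x₂ * f → x₁ ∣ f)
    (h12 : ∀ f, x₁ * y₂ - y₁ * x₂ ∣ (x₁ * y₄ - y₁ * x₄) * f → x₁ * y₂ - y₁ * x₂ ∣ f)
    (h34 : ∀ f, x₃ * y₄ - y₃ * x₄ ∣ (x₁ * y₃ - y₁ * x₃) * f → x₃ * y₄ - y₃ * x₄ ∣ f)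
    (hg : g ∈ Ideal.span {x₁ * y₂ - y₁ * x₂, x₂ * y₃ - y₂ * x₃, x₃ * y₄ - y₃ * x₄} ⊔
      Ideal.span {x₁ * y₃ - y₁ * x₃, x₂ * y₄ - y₂ * x₄, x₁ * y₄ - y₁ * x₄})
    (hg₃ : g ∈ Ideal.span {x₃, y₃, x₁ * y₂ - y₁ * x₂})
    (hg₂ : g ∈ Ideal.span {x₂, y₂, x₃ * y₄ - y₃ * x₄}) :
    g ∈ Ideal.span {x₁ * y₂ - y₁ * x₂, x₂ * y₃ - y₂ * x₃, x₃ * y₄ - y₃ * x₄} := by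
  obtain ⟨i, hi, j, hj, hij⟩ := Submodule.mem_sup.1 hg
  rw [Ideal.mem_span_triple_iff] at hi hj hg₃ hg₂ ⊢
  obtain ⟨k, l, m, rfl⟩ := hi
  obtain ⟨A, B, C, rfl⟩ := hj
  obtain ⟨a₁, a₂, a₃, ha⟩ := hg₃
  obtain ⟨a₁', a₂', a₃', ha'⟩ := hg₂
  obtain ⟨h₂0, h₂0', h₂1, h₂1', h₂3, h₂3', h₂4, h₂4'⟩ := h₂
  obtain ⟨h₃0, h₃0', h₃1, h₃1', h₃2, h₃2', h₃4, h₃4'⟩ := h₃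
  obtain ⟨b₁, b₂, hB⟩ := Ideal.mem_span_pair.1 (hρ₃ B)
  obtain ⟨c₁, c₂, hC⟩ := Ideal.mem_span_pair.1 (hρ₃ C)
  have e₃ := congrArg ρ₃ (hij.trans ha.symm)
  simp only [map_add, map_sub, map_mul, h₃0, h₃0', h₃1, h₃1', h₃2, h₃2', h₃4, h₃4'] at e₃
  obtain ⟨E, hE⟩ := h12 (x₁ * ρ₃ C + x₂ * ρ₃ B)
    ⟨x₁ * (ρ₃ a₃ - ρ₃ k) + x₄ * ρ₃ B, by linear_combination x₁ * e₃⟩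
  obtain ⟨F, hF⟩ := hx (ρ₃ B + y₁ * E) ⟨y₂ * E - ρ₃ C, by linear_combination hE⟩
  have hF' : ρ₃ C = y₂ * E - x₂ * F :=
    mul_left_cancel₀ hx₁ (by linear_combination hE - x₂ * hF)
  obtain ⟨d₁, d₂, hd⟩ := Ideal.mem_span_pair.1 (hρ₂ (A + c₁ * x₄ + c₂ * y₄))
  have hg' : (A + c₁ * x₄ + c₂ * y₄) * (x₁ * y₃ - y₁ * x₃)
      + (k - F * x₄ + E * y₄) * (x₁ * y₂ - y₁ * x₂)
      + (l + b₁ * x₄ + b₂ * y₄) * (x₂ * y₃ - y₂ * x₃)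
      + (m + b₁ * x₂ + b₂ * y₂ + c₁ * x₁ + c₂ * y₁) * (x₃ * y₄ - y₃ * x₄) = g := by
    linear_combination hij + (x₂ * y₄ - y₂ * x₄) * (hB - hF)
      + (x₁ * y₄ - y₁ * x₄) * (hC - hF')
  have e₂ := congrArg ρ₂ (hg'.trans ha'.symm)
  rw [map_add, map_add, map_add, map_mul] at e₂
  generalize A + c₁ * x₄ + c₂ * y₄ = A' at *
  generalize m + b₁ * x₂ + b₂ * y₂ + c₁ * x₁ + c₂ * y₁ = m' at *
  simp only [map_add, map_sub, map_mul, h₂0, h₂0', h₂1, h₂1', h₂3, h₂3', h₂4, h₂4'] at e₂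
  obtain ⟨G, hG⟩ := h34 (ρ₂ A') ⟨ρ₂ a₃' - ρ₂ m', by linear_combination e₂⟩
  refine ⟨k - F * x₄ + E * y₄ + d₁ * x₃ + d₂ * y₃, l + b₁ * x₄ + b₂ * y₄ + d₁ * x₁ + d₂ * y₁,
    m' + G * (x₁ * y₃ - y₁ * x₃), ?_⟩
  linear_combination hg' + (x₁ * y₃ - y₁ * x₃) * (hd - hG)

/-- A `2 × 2` determinant in four distinct indeterminates is prime. -/
theorem MvPolynomial.prime_X_mul_X_sub_X_mul_X {σ K : Type*} [Field K] {i j k l : σ}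
    (hij : i ≠ j) (hik : i ≠ k) (hil : i ≠ l) (hjl : j ≠ l) (hkl : k ≠ l) :
    Prime (X i * X l - X j * X k : MvPolynomial σ K) := by
  classical
  rw [sub_eq_add_neg]
  refine (irreducible_mul_X_add _ _ _ (X_ne_zero i) ?_ ?_ ?_).prime
  · simpa [vars_X] using hil.symm
  · intro h
    rw [vars_neg] at h
    have := vars_mul _ _ h
    simp [vars_X, hjl.symm, hkl.symm] at this
  · rw [(X_prime (R := K)).irreducible.isRelPrime_iff_not_dvd, dvd_neg, (X_prime).dvd_mul]
    simp [X_dvd_X, hij, hik]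

/-- The minors `[12]`, `[34]`, `[23]`, `[13]`, `[24]`, `[14]` of the vectors `p₀₀`, `p₀₀ + p₁₀`,
`p₀₁ + p₁₁`, `p₀₁`, indexed by `(i₁, i₃)`, generate all exchange binomials. -/
theorem exchange_eq_of_minors_eq_zero {R : Type*} [CommRing R] (p : Fin 2 → Fin 2 → Fin 2 → R)
    (h12 : p 0 0 0 * p 1 1 0 = p 0 1 0 * p 1 0 0)
    (h34 : p 0 0 1 * p 1 1 1 = p 0 1 1 * p 1 0 1)
    (h23 : (p 0 0 0 + p 1 0 0) * (p 0 1 1 + p 1 1 1) = (p 0 0 1 + p 1 0 1) * (p 0 1 0 + p 1 1 0))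
    (h13 : p 0 0 0 * (p 0 1 1 + p 1 1 1) = p 0 1 0 * (p 0 0 1 + p 1 0 1))
    (h24 : (p 0 0 0 + p 1 0 0) * p 0 1 1 = (p 0 1 0 + p 1 1 0) * p 0 0 1)
    (h14 : p 0 0 0 * p 0 1 1 = p 0 1 0 * p 0 0 1) (i₁ i₂ i₃ j₁ j₂ j₃ : Fin 2) :
    p i₁ i₂ i₃ * p j₁ j₂ j₃ = p i₁ j₂ i₃ * p j₁ i₂ j₃ := by
  fin_cases i₁ <;> fin_cases i₂ <;> fin_cases i₃ <;> fin_cases j₁ <;> fin_cases j₂ <;>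
    fin_cases j₃ <;> dsimp <;> grind

/-- Replacing the entries `p₁ⱼₖ` of the slice `k` by `-p₀ⱼₖ`. -/
noncomputable def sliceRetraction (k : Fin 2) :
    MvPolynomial (Fin 2 × Fin 2 × Fin 2) ℝ →ₐ[ℝ] MvPolynomial (Fin 2 × Fin 2 × Fin 2) ℝ :=
  aeval fun s => if s.1 = 1 ∧ s.2.2 = k then -X (0, s.2.1, k) else X s

theorem sliceRetraction_pVar (k i₁ i₂ i₃ : Fin 2) :
    sliceRetraction k (pVar i₁ i₂ i₃) =
      if i₁ = 1 ∧ i₃ = k then -pVar 0 i₂ k else pVar i₁ i₂ i₃ := by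
  simp [sliceRetraction, pVar]

theorem sub_sliceRetraction_mem (k : Fin 2) (f : MvPolynomial (Fin 2 × Fin 2 × Fin 2) ℝ) :
    f - sliceRetraction k f ∈
      Ideal.span {pVar 0 0 k + pVar 1 0 k, pVar 0 1 k + pVar 1 1 k} := by
  rw [← Ideal.Quotient.mk_eq_mk_iff_sub_mem]
  set I := Ideal.span {pVar 0 0 k + pVar 1 0 k, pVar 0 1 k + pVar 1 1 k}
  suffices h : Ideal.Quotient.mkₐ ℝ I = (Ideal.Quotient.mkₐ ℝ I).comp (sliceRetraction k) from
    DFunLike.congr_fun h f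
  ext ⟨i₁, i₂, i₃⟩
  change Ideal.Quotient.mk I (pVar i₁ i₂ i₃) =
    Ideal.Quotient.mk I (sliceRetraction k (pVar i₁ i₂ i₃))
  rw [sliceRetraction_pVar]
  split_ifs with h
  · obtain ⟨rfl, rfl⟩ := h
    rw [Ideal.Quotient.mk_eq_mk_iff_sub_mem, sub_neg_eq_add, add_comm]
    exact Ideal.subset_span (by fin_cases i₂ <;> simp)
  · rfl

/-- A prime polynomial `p` cancels a factor `q` that does not vanish at some zero of `p`. -/
theorem MvPolynomial.dvd_of_dvd_mul_of_eval {σ K : Type*} [Field K] {p q f : MvPolynomial σ K}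
    (hp : Prime p) (v : σ → K) (hpv : eval v p = 0) (hqv : eval v q ≠ 0) (h : p ∣ q * f) :
    p ∣ f := by
  refine (hp.dvd_or_dvd h).resolve_left fun hq => hqv ?_
  simpa [hpv] using map_dvd (eval v) hq

/-- primary decomposition of the CI ideal of
`{X₁ ⟂ X₂ | X₃, X₂ ⟂ X₃}` for binary random variables. -/
theorem contraction_ideal_decomposition_binary :
    Ideal.span {pVar 0 0 0 * pVar 1 1 0 - pVar 0 1 0 * pVar 1 0 0,
                pVar 0 0 1 * pVar 1 1 1 - pVar 0 1 1 * pVar 1 0 1,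
                (pVar 0 0 0 + pVar 1 0 0) * (pVar 0 1 1 + pVar 1 1 1)
                  - (pVar 0 0 1 + pVar 1 0 1) * (pVar 0 1 0 + pVar 1 1 0)} =
      Ideal.span { f | ∃ i₁ i₂ i₃ j₁ j₂ j₃ : Fin 2,
          f = pVar i₁ i₂ i₃ * pVar j₁ j₂ j₃ - pVar i₁ j₂ i₃ * pVar j₁ i₂ j₃ } ⊓
      Ideal.span {pVar 0 1 1 + pVar 1 1 1, pVar 0 0 1 + pVar 1 0 1,
                  pVar 0 1 0 * pVar 1 0 0 - pVar 0 0 0 * pVar 1 1 0} ⊓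
      Ideal.span {pVar 0 1 0 + pVar 1 1 0, pVar 0 0 0 + pVar 1 0 0,
                  pVar 0 1 1 * pVar 1 0 1 - pVar 0 0 1 * pVar 1 1 1} := by
  rw [inf_assoc]
  set a := pVar 0 0 0 with ha
  set b := pVar 0 1 0 with hb
  set c := pVar 1 0 0 with hc
  set d := pVar 1 1 0 with hd
  set e := pVar 0 0 1 with he
  set f := pVar 0 1 1 with hf
  set g := pVar 1 0 1 with hg
  set h := pVar 1 1 1 with hh
  have hpath : Ideal.span {a * d - b * c, e * h - f * g, (a + c) * (f + h) - (e + g) * (b + d)} =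
      Ideal.span {a * (b + d) - b * (a + c), (a + c) * (f + h) - (b + d) * (e + g),
        (e + g) * f - (f + h) * e} := by
    apply le_antisymm <;> rw [Ideal.span_le] <;> rintro z (rfl | rfl | rfl) <;>
      rw [SetLike.mem_coe, Ideal.mem_span_triple_iff]
    · exact ⟨1, 0, 0, by ring⟩
    · exact ⟨0, 0, -1, by ring⟩
    · exact ⟨0, 1, 0, by ring⟩
    · exact ⟨1, 0, 0, by ring⟩
    · exact ⟨0, 0, 1, by ring⟩
    · exact ⟨0, -1, 0, by ring⟩
  apply le_antisymm
  · refine le_inf ?_ (le_inf ?_ ?_) <;> rw [Ideal.span_le] <;> rintro z (rfl | rfl | rfl)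
    · exact Ideal.subset_span ⟨0, 0, 0, 1, 1, 0, rfl⟩
    · exact Ideal.subset_span ⟨0, 0, 1, 1, 1, 1, rfl⟩
    · have hexch : ∀ i j : Fin 2, pVar i 0 0 * pVar j 1 1 - pVar i 1 0 * pVar j 0 1 ∈
          Ideal.span { f | ∃ i₁ i₂ i₃ j₁ j₂ j₃ : Fin 2,
            f = pVar i₁ i₂ i₃ * pVar j₁ j₂ j₃ - pVar i₁ j₂ i₃ * pVar j₁ i₂ j₃ } :=
        fun i j => Ideal.subset_span ⟨i, 0, 0, j, 1, 1, rfl⟩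
      have := add_mem (add_mem (hexch 0 0) (hexch 0 1)) (add_mem (hexch 1 0) (hexch 1 1))
      rw [SetLike.mem_coe]
      convert this using 1
      ring
    all_goals rw [SetLike.mem_coe, Ideal.mem_span_triple_iff]
    · exact ⟨0, 0, -1, by ring⟩
    · exact ⟨e, -f, 0, by ring⟩
    · exact ⟨a + c, -(b + d), 0, by ring⟩
    · exact ⟨a, -b, 0, by ring⟩
    · exact ⟨0, 0, -1, by ring⟩
    · exact ⟨-(e + g), f + h, 0, by ring⟩
  · rintro z ⟨hz, hz₃, hz₂⟩
    have h12 : a * (b + d) - b * (a + c) = a * d - b * c := by ring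
    have h34 : (e + g) * f - (f + h) * e = -(e * h - f * g) := by ring
    rw [hpath]
    refine mem_span_path_minors (x₁ := a) (y₁ := b) (x₂ := a + c) (y₂ := b + d) (x₃ := e + g)
      (y₃ := f + h) (x₄ := e) (y₄ := f) (RingHomClass.toRingHom (sliceRetraction 0))
      (RingHomClass.toRingHom (sliceRetraction 1)) ?_ ?_
      (sub_sliceRetraction_mem 0) (sub_sliceRetraction_mem 1) (X_ne_zero (0, 0, 0)) ?_ ?_ ?_ ?_ ?_ ?_
    · simp [ha, hb, hc, hd, he, hf, hg, hh, sliceRetraction_pVar]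
    · simp [ha, hb, hc, hd, he, hf, hg, hh, sliceRetraction_pVar]
    · refine fun q => dvd_of_dvd_mul_of_eval (X_prime) (fun s => if s = (1, 0, 0) then 1 else 0)
        ?_ ?_ <;> simp [ha, hc, pVar]
    · rw [h12]
      refine fun q => dvd_of_dvd_mul_of_eval
        (prime_X_mul_X_sub_X_mul_X (by decide) (by decide) (by decide) (by decide) (by decide))
        (fun s => if s = (0, 0, 0) ∨ s = (0, 1, 1) then 1 else 0) ?_ ?_ <;>
        simp [ha, hb, hc, hd, he, hf, pVar]
    · rw [h34]
      refine fun q => dvd_of_dvd_mul_of_eval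
        (prime_X_mul_X_sub_X_mul_X (by decide) (by decide) (by decide) (by decide) (by decide)).neg
        (fun s => if s = (0, 0, 0) ∨ s = (0, 1, 1) then 1 else 0) ?_ ?_ <;>
        simp [ha, hb, he, hf, hg, hh, pVar]
    · refine (Ideal.span_le (I := _ ⊔ _)).2 ?_ hz
      rintro _ ⟨i₁, i₂, i₃, j₁, j₂, j₃, rfl⟩
      rw [← hpath, SetLike.mem_coe, ← Ideal.Quotient.mk_eq_mk_iff_sub_mem, map_mul, map_mul]
      refine exchange_eq_of_minors_eq_zero (fun i j k => Ideal.Quotient.mk _ (pVar i j k))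
        ?_ ?_ ?_ ?_ ?_ ?_ i₁ i₂ i₃ j₁ j₂ j₃ <;>
        simp only [← map_mul, ← map_add, Ideal.Quotient.mk_eq_mk_iff_sub_mem]
      · exact Ideal.mem_sup_left (Ideal.subset_span (by simp [ha, hb, hc, hd]))
      · exact Ideal.mem_sup_left (Ideal.subset_span (by simp [he, hf, hg, hh]))
      · exact Ideal.mem_sup_left (Ideal.subset_span
          (by simp [ha, hb, hc, hd, he, hf, hg, hh]))
      · exact Ideal.mem_sup_right (Ideal.subset_span (.inl rfl))
      · exact Ideal.mem_sup_right (Ideal.subset_span (.inr (.inl rfl)))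
      · exact Ideal.mem_sup_right (Ideal.subset_span (.inr (.inr rfl)))
    · rw [SetLike.mem_coe, Ideal.mem_span_triple_iff] at hz₃
      obtain ⟨k, l, m, rfl⟩ := hz₃
      exact Ideal.mem_span_triple_iff.2 ⟨l, k, -m, by ring⟩
    · rw [SetLike.mem_coe, Ideal.mem_span_triple_iff] at hz₂
      obtain ⟨k, l, m, rfl⟩ := hz₂
      exact Ideal.mem_span_triple_iff.2 ⟨l, k, m, by ring⟩
end

section
/- Work in the polynomial ring $R = \mathbb{R}[p_x : x \in \{1,2\}^4]$ in 16 indeterminates indexed by the states of four binary random variables $X_1, X_2, X_3, X_4$. Let $I_{\mathrm{global}(C_4)} = I_{1 \perp 3 \mid \{2,4\}} + I_{2 \perp 4 \mid \{1,3\}}$, where $I_{1\perp 3\mid\{2,4\}}$ is generated by all $p_{a\, i_2\, b\, i_4} p_{c\, i_2\, d\, i_4} - p_{a\, i_2\, d\, i_4} p_{c\, i_2\, b\, i_4}$ and $I_{2\perp 4\mid\{1,3\}}$ by all $p_{i_1\, a\, i_3\, b} p_{i_1\, c\, i_3\, d} - p_{i_1\, a\, i_3\, d} p_{i_1\, c\,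 i_3\, b}$. Let $I_{C_4}$ be the kernel of the ring homomorphism $\varphi : R \to \mathbb{R}[a^{(e)}_{uv} : e \in \{1,2,3,4\},\ u, v \in \{1,2\}]$ sending $p_{x_1 x_2 x_3 x_4} \mapsto a^{(1)}_{x_1 x_2} a^{(2)}_{x_2 x_3} a^{(3)}_{x_3 x_4} a^{(4)}_{x_4 x_1}$. For $i \in \{1,2,3,4\}$ (indices of $x$ taken cyclically, so $x_5 = x_1$) let $P_i = \langle p_x : x_i = x_{i+1} \rangle$ and $P'_i = \langle p_x : x_i \neq x_{i+1} \rangle$. Then the set of minimal primes of $I_{\mathrm{global}(C_4)}$ is exactly $\{I_{C_4}\} \cup \{P_i : i\} \cup \{P'_i : i\}$. -/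
open MvPolynomial

/-- The global Markov CI ideal of the four-cycle `C₄` for four binary random
variables: `I_{1 ⟂ 3 | {2,4}} + I_{2 ⟂ 4 | {1,3}}`.  Joint states are tuples
`x : Fin 4 → Fin 2`. -/
noncomputable def globalC4Binary : Ideal (MvPolynomial (Fin 4 → Fin 2) ℝ) :=
  Ideal.span { f | ∃ x y : Fin 4 → Fin 2, x 1 = y 1 ∧ x 3 = y 3 ∧
      f = X x * X y -
        X (Function.update x 2 (y 2)) * X (Function.update y 2 (x 2)) } +
  Ideal.span { f | ∃ x y : Fin 4 → Fin 2, x 0 = y 0 ∧ x 2 = y 2 ∧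
      f = X x * X y -
        X (Function.update x 3 (y 3)) * X (Function.update y 3 (x 3)) }

/-- The toric ideal `I_{C₄}`: the kernel of the monomial parametrization of the
binary graphical model of the four-cycle,
`p_{x₁x₂x₃x₄} ↦ a⁽¹⁾_{x₁x₂} a⁽²⁾_{x₂x₃} a⁽³⁾_{x₃x₄} a⁽⁴⁾_{x₄x₁}`. -/
noncomputable def toricC4Binary : Ideal (MvPolynomial (Fin 4 → Fin 2) ℝ) :=
  RingHom.ker (aeval (R := ℝ) (fun x : Fin 4 → Fin 2 =>
    (X (0, x 0, x 1) * X (1, x 1, x 2) * X (2, x 2, x 3) * X (3, x 3, x 0) :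
      MvPolynomial (Fin 4 × Fin 2 × Fin 2) ℝ))).toRingHom

/-- The monomial ideal `Pᵢ = ⟨p_x : xᵢ = x_{i+1}⟩` (indices cyclic). -/
noncomputable def PIdeal (i : Fin 4) : Ideal (MvPolynomial (Fin 4 → Fin 2) ℝ) :=
  Ideal.span { f | ∃ x : Fin 4 → Fin 2, x i = x (i + 1) ∧ f = X x }

/-- The monomial ideal `P'ᵢ = ⟨p_x : xᵢ ≠ x_{i+1}⟩` (indices cyclic). -/
noncomputable def PIdeal' (i : Fin 4) : Ideal (MvPolynomial (Fin 4 → Fin 2) ℝ) :=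
  Ideal.span { f | ∃ x : Fin 4 → Fin 2, x i ≠ x (i + 1) ∧ f = X x }

/-- Arrays indexed by the joint states of four binary variables, in curried form. -/
abbrev BinaryTable (α : Type*) := Bool → Bool → Bool → Bool → α

namespace BinaryTable

/-- Cyclic relabelling of the four variables. -/
def rot {α : Type*} (q : BinaryTable α) : BinaryTable α := fun a b c d => q d a b c

/-- Relabelling of the states of the last three variables. -/
def flip {α : Type*} (f g h : Bool) (q : BinaryTable α) : BinaryTable α :=
  fun a b c d => q a (b ^^ f) (c ^^ g) (d ^^ h)

/-- `T` misses all states whose first two coordinates agree, or all those where they differ. -/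
def MissesEdge (T : BinaryTable Bool) : Prop :=
  (∀ a c d, T a a c d = false) ∨ ∀ a c d, T a (!a) c d = false

/-- One of the two slices of `T` in the first coordinate contains the other one, and the
containment is compatible with the product structure in the second and fourth coordinates. -/
def Dominated (T : BinaryTable Bool) : Prop :=
  ∃ e, (∀ b c d, T (!e) b c d = true → T e b c d = true) ∧
    ((∀ b c d, T (!e) b c d = false) ∨
      ∃ s c₀ t, T (!e) s c₀ t = true ∧
        ∀ b c d, T e b c d = true → b = s ∨ d = t ∨ T e b c₀ d = true)

/-- The number of conditions among `a ≠ b`, `b ≠ c`, `c ≠ d`, `d = a` which hold. -/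
def frustration (a b c d : Bool) : ℕ :=
  (a ^^ b).toNat + (b ^^ c).toNat + (c ^^ d).toNat + (!(d ^^ a)).toNat

/-- Every state in `T` satisfies exactly one of `a ≠ b`, `b ≠ c`, `c ≠ d`, `d = a`. -/
def OneFrustrated (T : BinaryTable Bool) : Prop :=
  ∀ a b c d, T a b c d = true → frustration a b c d = 1

/-- The three possible shapes of the support of a table satisfying the conditional independence
constraints of the four-cycle. -/
def Trichotomy (T : BinaryTable Bool) : Prop :=
  (T.MissesEdge ∨ T.rot.MissesEdge ∨ T.rot.rot.MissesEdge ∨ T.rot.rot.rot.MissesEdge) ∨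
  (T.Dominated ∨ T.rot.Dominated ∨ T.rot.rot.Dominated ∨ T.rot.rot.rot.Dominated) ∨
  ∃ f g h, (T.flip f g h).OneFrustrated

instance (T : BinaryTable Bool) : Decidable T.MissesEdge := by
  unfold MissesEdge; infer_instance

instance (T : BinaryTable Bool) : Decidable T.Dominated := by
  unfold Dominated; infer_instance

instance (T : BinaryTable Bool) : Decidable T.OneFrustrated := by
  unfold OneFrustrated; infer_instance

instance (T : BinaryTable Bool) : Decidable T.Trichotomy := by
  unfold Trichotomy; infer_instance

/-- The two-by-two array with the given entries. -/
def quad (w x y z i j : Bool) : Bool :=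
  bif i then (bif j then z else y) else bif j then x else w

lemma eq_quad (R : Bool → Bool → Bool) :
    R = quad (R false false) (R false true) (R true false) (R true true) := by
  funext i j
  cases i <;> cases j <;> rfl

/-- The table whose slices in the first and third coordinates are the given arrays. -/
def ofSlices (R₀₀ R₀₁ R₁₀ R₁₁ : Bool → Bool → Bool) : BinaryTable Bool := fun a b c d =>
  (bif a then (bif c then R₁₁ else R₁₀) else bif c then R₀₁ else R₀₀) b d

lemma eq_ofSlices (T : BinaryTable Bool) :
    T = ofSlices (fun b d => T false b false d) (fun b d => T false b true d)
      (fun b d => T true b false d) (fun b d => T true b true d) := by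
  funext a b c d
  cases a <;> cases c <;> rfl

/-- The diagonal and the antidiagonal of a two-by-two array are both full or both not full. -/
def Balanced (w x y z : Bool) : Prop := (w && z) = (x && y)

instance (w x y z : Bool) : Decidable (Balanced w x y z) := by
  unfold Balanced; infer_instance

lemma trichotomy_quad : ∀ w x y z, Balanced w x y z →
    ∀ w' x' y' z', Balanced w' x' y' z' →
    ∀ w'' x'' y'' z'', Balanced w'' x'' y'' z'' →
    ∀ w₃ x₃ y₃ z₃, Balanced w₃ x₃ y₃ z₃ →
    Balanced w w' w'' w₃ → Balanced x x' x'' x₃ → Balanced y y' y'' y₃ → Balanced z z' z'' z₃ →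
    Trichotomy
      (ofSlices (quad w x y z) (quad w' x' y' z') (quad w'' x'' y'' z'') (quad w₃ x₃ y₃ z₃)) := by
  decide +kernel

theorem trichotomy (T : BinaryTable Bool)
    (h₁ : ∀ a c, Balanced (T a false c false) (T a false c true) (T a true c false)
      (T a true c true))
    (h₂ : ∀ b d, Balanced (T false b false d) (T false b true d) (T true b false d)
      (T true b true d)) : T.Trichotomy := by
  rw [eq_ofSlices T, eq_quad fun b d => T false b false d, eq_quad fun b d => T false b true d,
    eq_quad fun b d => T true b false d, eq_quad fun b d => T true b true d]
  exact trichotomy_quad _ _ _ _ (h₁ _ _) _ _ _ _ (h₁ _ _) _ _ _ _ (h₁ _ _) _ _ _ _ (h₁ _ _)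
    (h₂ _ _) (h₂ _ _) (h₂ _ _) (h₂ _ _)

section Field

open scoped Classical Polynomial

variable {K : Type*} [Field K]

/-- The table factors along the edges of the four-cycle. -/
def Factors (q : BinaryTable K) : Prop :=
  ∃ A B C D : Bool → Bool → K, ∀ a b c d, q a b c d = A a b * B b c * C c d * D d a

/-- The table is the value at `0` of a polynomial curve of tables that factor. -/
def IsLimit (q : BinaryTable K) : Prop :=
  ∃ Q : BinaryTable K[X],
    (∀ t ≠ 0, Factors fun a b c d => (Q a b c d).eval t) ∧
      ∀ a b c d, (Q a b c d).eval 0 = q a b c d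

/-- The conditional independence constraints of the four-cycle. -/
structure IsMarkov (q : BinaryTable K) : Prop where
  swap_two : ∀ a b c d a' c', q a b c d * q a' b c' d = q a b c' d * q a' b c d
  swap_three : ∀ a b c d b' d', q a b c d * q a b' c d' = q a b c d' * q a b' c d

/-- The support of a table. -/
noncomputable def support (q : BinaryTable K) : BinaryTable Bool :=
  fun a b c d => decide (q a b c d ≠ 0)

lemma Factors.isLimit {q : BinaryTable K} (h : q.Factors) : q.IsLimit :=
  ⟨fun a b c d => .C (q a b c d), fun t _ => by simpa using h, by simp⟩

lemma Factors.of_rot {q : BinaryTable K} (h : q.rot.Factors) : q.Factors := by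
  obtain ⟨A, B, C, D, h⟩ := h
  refine ⟨D, A, B, C, fun a b c d => ?_⟩
  rw [show q a b c d = q.rot b c d a from rfl, h]
  ring

lemma Factors.of_flip {q : BinaryTable K} {f g h : Bool} (hq : (q.flip f g h).Factors) :
    q.Factors := by
  obtain ⟨A, B, C, D, hq⟩ := hq
  refine ⟨fun a b => A a (b ^^ f), fun b c => B (b ^^ f) (c ^^ g), fun c d => C (c ^^ g) (d ^^ h),
    fun d a => D (d ^^ h) a, fun a b c d => ?_⟩
  rw [← hq]
  simp [flip]

lemma IsLimit.of_flip {q : BinaryTable K} {f g h : Bool} (hq : (q.flip f g h).IsLimit) :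
    q.IsLimit := by
  obtain ⟨Q, hQ, hq⟩ := hq
  refine ⟨Q.flip f g h, fun t ht => .of_flip (f := f) (g := g) (h := h) ?_, fun a b c d => ?_⟩
  · obtain ⟨A, B, C, D, h⟩ := hQ t ht
    exact ⟨A, B, C, D, fun a b c d => by simpa [flip] using h a b c d⟩
  · simp [flip, hq]

lemma IsMarkov.rot {q : BinaryTable K} (h : q.IsMarkov) : q.rot.IsMarkov where
  swap_two a b c d a' c' := by
    simpa [BinaryTable.rot, mul_comm] using h.swap_three d a b c a' c'
  swap_three a b c d b' d' := by
    rw [mul_comm, mul_comm (BinaryTable.rot q a b c d')]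
    simpa [BinaryTable.rot, mul_comm] using h.swap_two d' a b' c d b

lemma IsMarkov.trichotomy {q : BinaryTable K} (h : q.IsMarkov) : q.support.Trichotomy := by
  apply BinaryTable.trichotomy
  · intro a c
    have := h.swap_three a false c false true true
    have h' := congrArg (fun z => decide (z ≠ 0)) this
    simpa [Balanced, support] using h'
  · intro b d
    have := h.swap_two false b false d true true
    have h' := congrArg (fun z => decide (z ≠ 0)) this
    simpa [Balanced, support] using h'

lemma exists_eq_mul_of_rank_le_one (m : Bool → Bool → K)
    (h : ∀ i j i' j', m i j * m i' j' = m i j' * m i' j) :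
    ∃ u v : Bool → K, ∀ i j, m i j = u i * v j := by
  by_cases h₀ : ∃ s t, m s t ≠ 0
  · obtain ⟨s, t, hst⟩ := h₀
    refine ⟨fun i => m i t, fun j => m s j / m s t, fun i j => ?_⟩
    field_simp
    exact h i j s t
  · push Not at h₀
    exact ⟨0, 0, by simp [h₀]⟩

lemma factors_of_dominated {q : BinaryTable K} (h : q.IsMarkov) (hd : q.support.Dominated) :
    q.Factors := by
  obtain ⟨e, hsub, hd⟩ := hd
  simp only [support, decide_eq_true_eq, decide_eq_false_iff_not, not_not] at hsub hd
  have hρ : ∀ b d, ∃ ρ, ∀ c, q (!e) b c d = q e b c d * ρ := by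
    intro b d
    by_cases h₀ : ∃ c, q e b c d ≠ 0
    · obtain ⟨c, hc⟩ := h₀
      refine ⟨q (!e) b c d / q e b c d, fun c' => ?_⟩
      field_simp
      linear_combination h.swap_two (!e) b c' d e c
    · push Not at h₀
      refine ⟨0, fun c => ?_⟩
      by_contra hne
      exact hsub b c d (by simpa using hne) (h₀ c)
  choose ρ hρ using hρ
  have hαδ : ∃ α δ : Bool → K, ∀ b c d, q (!e) b c d = q e b c d * (α b * δ d) := by
    rcases hd with h0 | ⟨s, c₀, t, hst, hs⟩
    · exact ⟨0, 0, by simp [h0]⟩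
    · rw [hρ] at hst
      have hst₀ := left_ne_zero_of_mul hst
      have hρst := right_ne_zero_of_mul hst
      refine ⟨fun b => ρ b t, fun d => ρ s d / ρ s t, fun b c d => ?_⟩
      rw [hρ]
      by_cases hq : q e b c d = 0
      · simp [hq]
      congr 1
      rw [mul_div_assoc', eq_div_iff hρst]
      rcases hs b c d hq with rfl | rfl | hbd
      · ring
      · ring
      · have h1 := h.swap_three e b c₀ d s t
        have h2 := h.swap_three (!e) b c₀ d s t
        simp only [hρ] at h2
        apply mul_left_cancel₀ (mul_ne_zero hbd hst₀)
        linear_combination h2 - ρ b t * ρ s d * h1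
  obtain ⟨α, δ, hαδ⟩ := hαδ
  choose u v huv using fun c =>
    exists_eq_mul_of_rank_le_one (fun b d => q e b c d) fun b d b' d' =>
      h.swap_three e b c d b' d'
  refine ⟨fun a b => if a = e then 1 else α b, fun b c => u c b, fun c d => v c d,
    fun d a => if a = e then 1 else δ d, fun a b c d => ?_⟩
  by_cases ha : a = e
  · simp [ha, huv]
  · obtain rfl : a = !e := Bool.eq_not_of_ne ha
    simp only [hαδ, huv, ha, if_false]
    ring

lemma isLimit_of_oneFrustrated {q : BinaryTable K} (hq : q.support.OneFrustrated) :
    q.IsLimit := by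
  let α : Bool → Bool → K := fun a b => if a = b then 1 else q a b b b
  let β : Bool → Bool → K := fun b c => if b = c then 1 else q b b c c
  let γ : Bool → Bool → K := fun c d => if c = d then 1 else q c c c d
  let δ : Bool → Bool → K := fun d a => if d = a then q a a a a else 1
  refine ⟨fun a b c d => .C (α a b * β b c * γ c d * δ d a) * .X ^ (frustration a b c d - 1),
    fun t ht => ⟨fun a b => α a b * t ^ (a ^^ b).toNat, fun b c => β b c * t ^ (b ^^ c).toNat,
      fun c d => γ c d * t ^ (c ^^ d).toNat, fun d a => δ d a * t ^ (!(d ^^ a)).toNat * t⁻¹, ?_⟩, ?_⟩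
  · intro a b c d
    have h1 : 1 ≤ frustration a b c d := by revert a b c d; decide
    have : t ^ (frustration a b c d - 1) = t ^ frustration a b c d * t⁻¹ := by
      rw [pow_sub₀ _ ht h1, pow_one]
    simp only [Polynomial.eval_mul, Polynomial.eval_C, Polynomial.eval_pow, Polynomial.eval_X, this]
    simp only [frustration, pow_add]
    ring
  · intro a b c d
    by_cases h1 : frustration a b c d = 1
    · have : q a b c d = α a b * β b c * γ c d * δ d a := by
        revert h1
        cases a <;> cases b <;> cases c <;> cases d <;> simp [frustration, α, β, γ, δ]
      simp [h1, this]
    · have h0 : q a b c d = 0 := by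
        by_contra hne
        exact h1 (hq a b c d (by simpa [support] using hne))
      have : frustration a b c d - 1 ≠ 0 := by
        clear h0
        revert a b c d
        decide
      simp [this, h0]

theorem IsMarkov.missesEdge_or_isLimit {q : BinaryTable K} (h : q.IsMarkov) :
    (q.support.MissesEdge ∨ q.support.rot.MissesEdge ∨ q.support.rot.rot.MissesEdge ∨
      q.support.rot.rot.rot.MissesEdge) ∨ q.IsLimit := by
  rcases h.trichotomy with hm | hd | ⟨f, g, k, hf⟩
  · exact .inl hm
  · refine .inr (Factors.isLimit ?_)
    rcases hd with hd | hd | hd | hd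
    · exact factors_of_dominated h hd
    · exact (factors_of_dominated h.rot hd).of_rot
    · exact (factors_of_dominated h.rot.rot hd).of_rot.of_rot
    · exact (factors_of_dominated h.rot.rot.rot hd).of_rot.of_rot.of_rot
  · exact .inr (isLimit_of_oneFrustrated (q := q.flip f g k) hf).of_flip

end Field

end BinaryTable

/-- The value of a table, read as a point of affine space. -/
def BinaryTable.toPoint {α : Type*} (q : BinaryTable α) (x : Fin 4 → Fin 2) : α :=
  q (finTwoEquiv (x 0)) (finTwoEquiv (x 1)) (finTwoEquiv (x 2)) (finTwoEquiv (x 3))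

lemma mem_toricC4Binary {f : MvPolynomial (Fin 4 → Fin 2) ℝ} :
    f ∈ toricC4Binary ↔ aeval (R := ℝ) (fun x : Fin 4 → Fin 2 =>
      (X (0, x 0, x 1) * X (1, x 1, x 2) * X (2, x 2, x 3) * X (3, x 3, x 0) :
        MvPolynomial (Fin 4 × Fin 2 × Fin 2) ℝ)) f = 0 := Iff.rfl

section Points

variable {K : Type*} [Field K] [Algebra ℝ K]

lemma BinaryTable.Factors.aeval_eq_zero {q : BinaryTable K} (hq : q.Factors)
    {f : MvPolynomial (Fin 4 → Fin 2) ℝ} (hf : f ∈ toricC4Binary) : aeval q.toPoint f = 0 := by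
  obtain ⟨A, B, C, D, hq⟩ := hq
  let ψ : MvPolynomial (Fin 4 × Fin 2 × Fin 2) ℝ →ₐ[ℝ] K :=
    aeval fun z => ![A, B, C, D] z.1 (finTwoEquiv z.2.1) (finTwoEquiv z.2.2)
  have hψ := congrArg ψ (mem_toricC4Binary.1 hf)
  rw [map_zero, ← AlgHom.comp_apply] at hψ
  rw [← hψ]
  congr 1
  ext x
  simp [ψ, BinaryTable.toPoint, hq]

lemma BinaryTable.IsLimit.aeval_eq_zero {q : BinaryTable K} (hq : q.IsLimit)
    {f : MvPolynomial (Fin 4 → Fin 2) ℝ} (hf : f ∈ toricC4Binary) : aeval q.toPoint f = 0 := by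
  obtain ⟨Q, hQ, hq⟩ := hq
  have key (t : K) : (aeval Q.toPoint f).eval t =
      aeval (BinaryTable.toPoint fun a b c d => (Q a b c d).eval t) f := by
    rw [← Polynomial.coe_aeval_eq_eval, ← AlgHom.restrictScalars_apply ℝ, ← AlgHom.comp_apply]
    congr 1
    ext x
    simp [BinaryTable.toPoint]
  have hF : aeval Q.toPoint f = 0 := by
    have : Infinite K := .of_injective _ (algebraMap ℝ K).injective
    refine Polynomial.eq_zero_of_infinite_isRoot _
      ((Set.finite_singleton (0 : K)).infinite_compl.mono fun t ht => ?_)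
    rw [Set.mem_ofPred_eq, Polynomial.IsRoot, key]
    exact (hQ t ht).aeval_eq_zero hf
  have h0 := key 0
  simp only [hF, hq, Polynomial.eval_zero] at h0
  exact h0.symm

end Points

section VariableIdeals

variable {σ R : Type*} [CommRing R] [IsDomain R]

lemma isPrime_span_X_image (s : Set σ) :
    (Ideal.span (X '' s : Set (MvPolynomial σ R))).IsPrime := by
  classical
  let φ : MvPolynomial σ R →ₐ[R] MvPolynomial σ R := aeval fun i => if i ∈ s then 0 else X i
  have hmk : (Ideal.Quotient.mkₐ R (Ideal.span (X '' s))).comp φ =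
      Ideal.Quotient.mkₐ R (Ideal.span (X '' s)) := by
    ext i
    by_cases hi : i ∈ s
    · simpa [φ, hi] using
        (Ideal.Quotient.eq_zero_iff_mem.2 (Ideal.subset_span (Set.mem_image_of_mem X hi))).symm
    · simp [φ, hi]
  have hker : Ideal.span (X '' s) = RingHom.ker φ := by
    apply le_antisymm
    · rw [Ideal.span_le]
      rintro _ ⟨i, hi, rfl⟩
      simp [φ, hi]
    · intro f hf
      have := DFunLike.congr_fun hmk f
      rw [AlgHom.comp_apply, (RingHom.mem_ker).1 hf, map_zero] at this
      exact Ideal.Quotient.eq_zero_iff_mem.1 this.symm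
  rw [hker]
  exact RingHom.ker_isPrime φ

lemma X_mem_span_X_image {s : Set σ} {i : σ} :
    (X i : MvPolynomial σ R) ∈ Ideal.span (X '' s) ↔ i ∈ s := by
  classical
  refine ⟨fun h => ?_, fun h => Ideal.subset_span (Set.mem_image_of_mem _ h)⟩
  by_contra hi
  have hle : Ideal.span (X '' s) ≤
      RingHom.ker (aeval (R := R) fun j => if j = i then (1 : R) else 0) := by
    rw [Ideal.span_le]
    rintro _ ⟨j, hj, rfl⟩
    simp [show j ≠ i by rintro rfl; exact hi hj]
  simpa using hle h

end VariableIdeals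

lemma PIdeal_eq (i : Fin 4) : PIdeal i = Ideal.span (X '' {x | x i = x (i + 1)}) := by
  simp only [PIdeal, Set.image, Set.mem_ofPred_eq, eq_comm]

lemma PIdeal'_eq (i : Fin 4) : PIdeal' i = Ideal.span (X '' {x | x i ≠ x (i + 1)}) := by
  simp only [PIdeal', Set.image, Set.mem_ofPred_eq, eq_comm]

lemma isPrime_toricC4Binary : toricC4Binary.IsPrime := RingHom.ker_isPrime _

lemma X_notMem_toricC4Binary (x : Fin 4 → Fin 2) : X x ∉ toricC4Binary := by
  simp [mem_toricC4Binary, X_ne_zero]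

lemma globalC4Binary_le_iff {J : Ideal (MvPolynomial (Fin 4 → Fin 2) ℝ)} :
    globalC4Binary ≤ J ↔
      (∀ x y : Fin 4 → Fin 2, x 1 = y 1 → x 3 = y 3 → X x * X y -
        X (Function.update x 2 (y 2)) * X (Function.update y 2 (x 2)) ∈ J) ∧
      ∀ x y : Fin 4 → Fin 2, x 0 = y 0 → x 2 = y 2 → X x * X y -
        X (Function.update x 3 (y 3)) * X (Function.update y 3 (x 3)) ∈ J := by
  simp only [globalC4Binary, Submodule.add_eq_sup, sup_le_iff, Ideal.span_le]
  constructor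
  · rintro ⟨h₁, h₂⟩
    exact ⟨fun x y h h' => h₁ ⟨x, y, h, h', rfl⟩, fun x y h h' => h₂ ⟨x, y, h, h', rfl⟩⟩
  · rintro ⟨h₁, h₂⟩
    refine ⟨?_, ?_⟩
    · rintro _ ⟨x, y, h, h', rfl⟩
      exact h₁ x y h h'
    · rintro _ ⟨x, y, h, h', rfl⟩
      exact h₂ x y h h'

lemma globalC4Binary_le_toric : globalC4Binary ≤ toricC4Binary := by
  rw [globalC4Binary_le_iff]
  constructor <;> intro x y h h' <;> rw [mem_toricC4Binary] <;> simp [h, h'] <;> ring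

lemma globalC4Binary_le_span_X_image {s : Set (Fin 4 → Fin 2)}
    (h₁ : ∀ x y : Fin 4 → Fin 2, x 1 = y 1 → x 3 = y 3 → x 0 ≠ y 0 → x 2 ≠ y 2 → x ∈ s ∨ y ∈ s)
    (h₂ : ∀ x y : Fin 4 → Fin 2, x 0 = y 0 → x 2 = y 2 → x 1 ≠ y 1 → x 3 ≠ y 3 → x ∈ s ∨ y ∈ s) :
    globalC4Binary ≤ Ideal.span (X '' s) := by
  have mul_mem {x y : Fin 4 → Fin 2} (h : x ∈ s ∨ y ∈ s) :
      X x * X y ∈ (Ideal.span (X '' s) : Ideal (MvPolynomial (Fin 4 → Fin 2) ℝ)) :=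
    h.elim (fun h => Ideal.mul_mem_right _ _ (X_mem_span_X_image.2 h))
      fun h => Ideal.mul_mem_left _ _ (X_mem_span_X_image.2 h)
  rw [globalC4Binary_le_iff]
  constructor <;> intro x y h h'
  · by_cases h0 : x 0 = y 0
    · have e₁ : Function.update x 2 (y 2) = y := by
        ext j; fin_cases j <;> simp [h, h', h0]
      have e₂ : Function.update y 2 (x 2) = x := by
        ext j; fin_cases j <;> simp [h, h', h0]
      simp [e₁, e₂, mul_comm]
    by_cases h2 : x 2 = y 2
    · rw [← h2, Function.update_eq_self, h2, Function.update_eq_self, sub_self]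
      exact zero_mem _
    exact sub_mem (mul_mem (h₁ x y h h' h0 h2))
      (mul_mem (h₁ _ _ (by simpa) (by simpa) (by simpa) (by simpa [eq_comm])))
  · by_cases h1 : x 1 = y 1
    · have e₁ : Function.update x 3 (y 3) = y := by
        ext j; fin_cases j <;> simp [h, h', h1]
      have e₂ : Function.update y 3 (x 3) = x := by
        ext j; fin_cases j <;> simp [h, h', h1]
      simp [e₁, e₂, mul_comm]
    by_cases h3 : x 3 = y 3
    · rw [← h3, Function.update_eq_self, h3, Function.update_eq_self, sub_self]
      exact zero_mem _
    exact sub_mem (mul_mem (h₂ x y h h' h1 h3))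
      (mul_mem (h₂ _ _ (by simpa) (by simpa) (by simpa) (by simpa [eq_comm])))

lemma globalC4Binary_le_PIdeal (i : Fin 4) : globalC4Binary ≤ PIdeal i := by
  rw [PIdeal_eq]
  apply globalC4Binary_le_span_X_image <;> intro x y <;> fin_cases i <;> simp <;> omega

lemma globalC4Binary_le_PIdeal' (i : Fin 4) : globalC4Binary ≤ PIdeal' i := by
  rw [PIdeal'_eq]
  apply globalC4Binary_le_span_X_image <;> intro x y <;> fin_cases i <;> simp <;> omega

lemma not_toricC4Binary_le_span (i : Fin 4) (e : Fin 2) :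
    ¬ toricC4Binary ≤ Ideal.span (X '' {x | x (i + 1) ≠ x i + e}) := by
  let w (s u v : Fin 2) (j : Fin 4) : Fin 2 := ![s, s + e, u, v] (j - i)
  let f : MvPolynomial (Fin 4 → Fin 2) ℝ :=
    X (w 0 0 0) * X (w 0 1 1) * X (w 1 0 1) * X (w 1 1 0) -
      X (w 0 0 1) * X (w 0 1 0) * X (w 1 0 0) * X (w 1 1 1)
  have hf : f ∈ toricC4Binary := by
    rw [mem_toricC4Binary]
    fin_cases i <;> simp [f, w] <;> ring
  let g : MvPolynomial (Fin 4 → Fin 2) ℝ →ₐ[ℝ] ℝ := aeval fun x =>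
    if x (i + 1) = x i + e ∧ x i + x (i + 2) + x (i + 3) = 0 then 1 else 0
  have hle : Ideal.span (X '' {x | x (i + 1) ≠ x i + e}) ≤ RingHom.ker g := by
    rw [Ideal.span_le]
    rintro _ ⟨x, hx, rfl⟩
    have hx : x (i + 1) ≠ x i + e := hx
    simp [g, hx]
  intro h
  have h0 : g f = 0 := hle (h hf)
  revert h0
  simp [f, g, w]

lemma not_toricC4Binary_le_PIdeal (i : Fin 4) : ¬ toricC4Binary ≤ PIdeal i := by
  convert not_toricC4Binary_le_span i 1 using 5 with x
  rw [PIdeal_eq]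
  congr! 3
  ext x
  simp
  omega

lemma not_toricC4Binary_le_PIdeal' (i : Fin 4) : ¬ toricC4Binary ≤ PIdeal' i := by
  rw [PIdeal'_eq]
  simpa [eq_comm] using not_toricC4Binary_le_span i 0

lemma not_span_X_image_le_toricC4Binary {s : Set (Fin 4 → Fin 2)} (hs : s.Nonempty) :
    ¬ Ideal.span (X '' s) ≤ toricC4Binary :=
  fun h => X_notMem_toricC4Binary hs.some (h (X_mem_span_X_image.2 hs.some_mem))

lemma span_X_image_le_iff {s t : Set (Fin 4 → Fin 2)} :
    (Ideal.span (X '' s) : Ideal (MvPolynomial (Fin 4 → Fin 2) ℝ)) ≤ Ideal.span (X '' t) ↔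
      s ⊆ t :=
  ⟨fun h _ hx => X_mem_span_X_image.1 (h (X_mem_span_X_image.2 hx)),
    fun h => Ideal.span_mono (Set.image_mono h)⟩

lemma isAntichain_components :
    IsAntichain (· ≤ ·) ({toricC4Binary} ∪ Set.range PIdeal ∪ Set.range PIdeal') := by
  rintro _ ((rfl | ⟨i, rfl⟩) | ⟨i, rfl⟩) _ ((rfl | ⟨j, rfl⟩) | ⟨j, rfl⟩) hne
  · exact absurd rfl hne
  · exact not_toricC4Binary_le_PIdeal j
  · exact not_toricC4Binary_le_PIdeal' j
  · rw [PIdeal_eq]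
    exact not_span_X_image_le_toricC4Binary ⟨0, rfl⟩
  · have hij : i ≠ j := by rintro rfl; exact hne rfl
    change ¬ (_ ≤ _)
    rw [PIdeal_eq, PIdeal_eq, span_X_image_le_iff]
    clear hne
    revert i j
    simp only [Set.subset_def, Set.mem_ofPred_eq]
    decide
  · change ¬ (_ ≤ _)
    rw [PIdeal_eq, PIdeal'_eq, span_X_image_le_iff]
    exact fun h => h (show (0 : Fin 4 → Fin 2) ∈ _ from rfl) rfl
  · rw [PIdeal'_eq]
    exact not_span_X_image_le_toricC4Binary ⟨Pi.single i 1, by simp⟩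
  · change ¬ (_ ≤ _)
    rw [PIdeal'_eq, PIdeal_eq, span_X_image_le_iff]
    clear hne
    revert i j
    simp only [Set.subset_def, Set.mem_ofPred_eq]
    decide
  · have hij : i ≠ j := by rintro rfl; exact hne rfl
    change ¬ (_ ≤ _)
    rw [PIdeal'_eq, PIdeal'_eq, span_X_image_le_iff]
    clear hne
    revert i j
    simp only [Set.subset_def, Set.mem_ofPred_eq]
    decide

lemma exists_component_le {J : Ideal (MvPolynomial (Fin 4 → Fin 2) ℝ)} (hJ : J.IsPrime)
    (hle : globalC4Binary ≤ J) :
    ∃ P ∈ ({toricC4Binary} ∪ Set.range PIdeal ∪ Set.range PIdeal' : Set (Ideal _)), P ≤ J := by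
  let K := FractionRing (MvPolynomial (Fin 4 → Fin 2) ℝ ⧸ J)
  let π : MvPolynomial (Fin 4 → Fin 2) ℝ →ₐ[ℝ] K :=
    (IsScalarTower.toAlgHom ℝ (MvPolynomial (Fin 4 → Fin 2) ℝ ⧸ J) K).comp
      (Ideal.Quotient.mkₐ ℝ J)
  have hπ (f) : π f = 0 ↔ f ∈ J := by
    simp [π, Ideal.Quotient.eq_zero_iff_mem]
  let w (a b c d : Bool) (j : Fin 4) : Fin 2 := finTwoEquiv.symm (![a, b, c, d] j)
  let q : BinaryTable K := fun a b c d => π (X (w a b c d))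
  have hq (x : Fin 4 → Fin 2) : q.toPoint x = π (X x) := by
    have : w (finTwoEquiv (x 0)) (finTwoEquiv (x 1)) (finTwoEquiv (x 2)) (finTwoEquiv (x 3)) =
        x := by
      funext j
      fin_cases j <;> simp [w]
    simp [BinaryTable.toPoint, q, this]
  have haeval (f) : aeval q.toPoint f = π f := by
    rw [funext hq]
    exact (DFunLike.congr_fun (aeval_unique π) f).symm
  have hmarkov : q.IsMarkov := by
    rw [globalC4Binary_le_iff] at hle
    constructor
    · intro a b c d a' c'
      have h := (hπ _).2 (hle.1 (w a b c d) (w a' b c' d) rfl rfl)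
      have e₁ : Function.update (w a b c d) 2 (w a' b c' d 2) = w a b c' d := by
        funext j; fin_cases j <;> rfl
      have e₂ : Function.update (w a' b c' d) 2 (w a b c d 2) = w a' b c d := by
        funext j; fin_cases j <;> rfl
      rw [e₁, e₂, map_sub, map_mul, map_mul, sub_eq_zero] at h
      exact h
    · intro a b c d b' d'
      have h := (hπ _).2 (hle.2 (w a b c d) (w a b' c d') rfl rfl)
      have e₁ : Function.update (w a b c d) 3 (w a b' c d' 3) = w a b c d' := by
        funext j; fin_cases j <;> rfl
      have e₂ : Function.update (w a b' c d') 3 (w a b c d 3) = w a b' c d := by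
        funext j; fin_cases j <;> rfl
      rw [e₁, e₂, map_sub, map_mul, map_mul, sub_eq_zero] at h
      exact h
  have hP (i : Fin 4) (h : ∀ x : Fin 4 → Fin 2, x i = x (i + 1) → q.toPoint x = 0) :
      ∃ P ∈ ({toricC4Binary} ∪ Set.range PIdeal ∪ Set.range PIdeal' : Set (Ideal _)), P ≤ J := by
    refine ⟨PIdeal i, .inl (.inr ⟨i, rfl⟩), Ideal.span_le.2 ?_⟩
    rintro _ ⟨x, hx, rfl⟩
    exact (hπ _).1 (hq x ▸ h x hx)
  have hP' (i : Fin 4) (h : ∀ x : Fin 4 → Fin 2, x i ≠ x (i + 1) → q.toPoint x = 0) :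
      ∃ P ∈ ({toricC4Binary} ∪ Set.range PIdeal ∪ Set.range PIdeal' : Set (Ideal _)), P ≤ J := by
    refine ⟨PIdeal' i, .inr ⟨i, rfl⟩, Ideal.span_le.2 ?_⟩
    rintro _ ⟨x, hx, rfl⟩
    exact (hπ _).1 (hq x ▸ h x hx)
  have hE {u v : Fin 2} (h : u ≠ v) : finTwoEquiv v = !finTwoEquiv u := by
    revert u v; decide
  rcases hmarkov.missesEdge_or_isLimit with hm | hl
  · simp only [BinaryTable.MissesEdge, BinaryTable.support, BinaryTable.rot,
      decide_eq_false_iff_not, not_not] at hm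
    rcases hm with (hm | hm) | (hm | hm) | (hm | hm) | (hm | hm)
    · refine hP 0 fun x hx => ?_
      rw [BinaryTable.toPoint, show x 0 = x 1 from hx]
      exact hm _ _ _
    · refine hP' 0 fun x hx => ?_
      rw [BinaryTable.toPoint, hE (show x 0 ≠ x 1 from hx)]
      exact hm _ _ _
    · refine hP 1 fun x hx => ?_
      rw [BinaryTable.toPoint, show x 1 = x 2 from hx]
      exact hm _ _ _
    · refine hP' 1 fun x hx => ?_
      rw [BinaryTable.toPoint, hE (show x 1 ≠ x 2 from hx)]
      exact hm _ _ _
    · refine hP 2 fun x hx => ?_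
      rw [BinaryTable.toPoint, show x 2 = x 3 from hx]
      exact hm _ _ _
    · refine hP' 2 fun x hx => ?_
      rw [BinaryTable.toPoint, hE (show x 2 ≠ x 3 from hx)]
      exact hm _ _ _
    · refine hP 3 fun x hx => ?_
      rw [BinaryTable.toPoint, show x 3 = x 0 from hx]
      exact hm _ _ _
    · refine hP' 3 fun x hx => ?_
      rw [BinaryTable.toPoint, hE (show x 3 ≠ x 0 from hx)]
      exact hm _ _ _
  · exact ⟨toricC4Binary, .inl (.inl rfl), fun f hf => (hπ f).1 (haeval f ▸ hl.aeval_eq_zero hf)⟩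

/-- the minimal primes of the CI ideal of the binary four-cycle
are exactly the toric ideal `I_{C₄}` together with the eight monomial ideals
`Pᵢ`, `P'ᵢ`. -/
theorem minimalPrimes_globalC4Binary :
    globalC4Binary.minimalPrimes =
      {toricC4Binary} ∪ Set.range PIdeal ∪ Set.range PIdeal' := by
  have hS : ∀ P ∈ {toricC4Binary} ∪ Set.range PIdeal ∪ Set.range PIdeal',
      P.IsPrime ∧ globalC4Binary ≤ P := by
    rintro _ ((rfl | ⟨i, rfl⟩) | ⟨i, rfl⟩)
    · exact ⟨isPrime_toricC4Binary, globalC4Binary_le_toric⟩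
    · exact ⟨PIdeal_eq i ▸ isPrime_span_X_image _, globalC4Binary_le_PIdeal i⟩
    · exact ⟨PIdeal'_eq i ▸ isPrime_span_X_image _, globalC4Binary_le_PIdeal' i⟩
  ext J
  constructor
  · intro hJ
    obtain ⟨P, hP, hPJ⟩ := exists_component_le hJ.1.1 hJ.1.2
    rwa [← hPJ.antisymm (hJ.2 (hS P hP) hPJ)]
  · intro hJ
    refine ⟨hS J hJ, fun L hL hLJ => ?_⟩
    obtain ⟨P, hP, hPL⟩ := exists_component_le hL.1 hL.2
    rwa [← isAntichain_components.eq hP hJ (hPL.trans hLJ)]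
end

section
/- Let $p : \{1,2\}^4 \to \mathbb{R}$ be a pmf (nonnegative values summing to 1), the joint distribution of binary random variables $X_1, X_2, X_3, X_4$. Then $p$ satisfies both $X_1 \perp\!\!\!\perp X_3 \mid (X_2, X_4)$ and $X_2 \perp\!\!\!\perp X_4 \mid (X_1, X_3)$ (i.e. $p(a,i_2,b,i_4)p(c,i_2,d,i_4) = p(a,i_2,d,i_4)p(c,i_2,b,i_4)$ and $p(i_1,a,i_3,b)p(i_1,c,i_3,d) = p(i_1,a,i_3,d)p(i_1,c,i_3,b)$ for all indices) if and only if at least one of the following holds: (1) $p$ lies in the closure (in $\mathbb{R}^{16}$) of the set of pmfs of the form $q(x_1,x_2,x_3,x_4) = a(x_1,x_2)\,b(x_2,x_3)\,c(x_3,x_4)\,d(x_4,x_1)$ for strictly positive functions $a,b,c,d : \{1,2\}^2 \to \mathbb{R}_{>0}$; (2) there is $i \in \{1,2,3,4\}$ such that $p(x) = 0$ for all $x$ with $x_i \neq x_{i+1}$ (indices cyclic, $x_5 = x_1$); (3) there is $i \in \{1,2,3,4\}$ such that $p(x) = 0$ for all $x$ with $x_i = x_{i+1}$. -/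
open Set Filter Topology

namespace FourCycle

/-- Functions of four binary variables. -/
abbrev Table := Fin 2 → Fin 2 → Fin 2 → Fin 2 → ℝ

/-- Unnormalised strictly positive products of edge potentials on the four-cycle. -/
def model : Set Table :=
  {P | ∃ α β γ δ : Fin 2 → Fin 2 → ℝ,
    (∀ u v, 0 < α u v) ∧ (∀ u v, 0 < β u v) ∧ (∀ u v, 0 < γ u v) ∧ (∀ u v, 0 < δ u v) ∧
    ∀ a b c d, P a b c d = α a b * β b c * γ c d * δ d a}

/-- The global Markov equations of the four-cycle. -/
def IsMarkov (P : Table) : Prop :=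
  (∀ a a' b c c' d, P a b c d * P a' b c' d = P a b c' d * P a' b c d) ∧
  ∀ a b b' c d d', P a b c d * P a b' c d' = P a b c d' * P a b' c d

/-- Some neighbouring pair of variables is almost surely equal, or almost surely different. -/
def HasLockedEdge (P : Table) : Prop :=
  ∃ e : Fin 2, (∀ a b c d, a + b = e → P a b c d = 0) ∨ (∀ a b c d, b + c = e → P a b c d = 0) ∨
    (∀ a b c d, c + d = e → P a b c d = 0) ∨ ∀ a b c d, d + a = e → P a b c d = 0

/-- Cyclic permutation of the variables. -/
def rotate (P : Table) : Table := fun a b c d => P b c d a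

/-- Exchange of `X₁` with `X₂` and of `X₃` with `X₄`. -/
def reflect (P : Table) : Table := fun a b c d => P b a d c

/-- Permutation of the values of the variables. -/
def shift (P : Table) (i j k l : Fin 2) : Table := fun a b c d => P (a + i) (b + j) (c + k) (d + l)

/-! ### Symmetries -/

lemma add_self_two (i : Fin 2) : i + i = 0 := by revert i; decide

lemma shift_shift (P : Table) (i j k l : Fin 2) : shift (shift P i j k l) i j k l = P := by
  funext a b c d
  simp [shift, add_assoc, add_self_two]

lemma rotate_mem_model {P : Table} (h : P ∈ model) : rotate P ∈ model := by
  obtain ⟨α, β, γ, δ, hα, hβ, hγ, hδ, h⟩ := h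
  exact ⟨δ, α, β, γ, hδ, hα, hβ, hγ, fun a b c d => by simp only [rotate, h]; ring⟩

lemma reflect_mem_model {P : Table} (h : P ∈ model) : reflect P ∈ model := by
  obtain ⟨α, β, γ, δ, hα, hβ, hγ, hδ, h⟩ := h
  exact ⟨fun u v => α v u, fun u v => δ v u, fun u v => γ v u, fun u v => β v u,
    fun _ _ => hα _ _, fun _ _ => hδ _ _, fun _ _ => hγ _ _, fun _ _ => hβ _ _,
    fun a b c d => by simp only [reflect, h]; ring⟩

lemma shift_mem_model {P : Table} (h : P ∈ model) (i j k l : Fin 2) : shift P i j k l ∈ model := by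
  obtain ⟨α, β, γ, δ, hα, hβ, hγ, hδ, h⟩ := h
  exact ⟨fun u v => α (u + i) (v + j), fun u v => β (u + j) (v + k),
    fun u v => γ (u + k) (v + l), fun u v => δ (u + l) (v + i),
    fun _ _ => hα _ _, fun _ _ => hβ _ _, fun _ _ => hγ _ _, fun _ _ => hδ _ _,
    fun a b c d => by simp only [shift, h]⟩

lemma continuous_rotate : Continuous rotate := by unfold rotate; fun_prop

lemma continuous_reflect : Continuous reflect := by unfold reflect; fun_prop

lemma continuous_shift (i j k l : Fin 2) : Continuous (fun P => shift P i j k l) := by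
  unfold shift; fun_prop

lemma IsMarkov.rotate {P : Table} (h : IsMarkov P) : IsMarkov (rotate P) :=
  ⟨fun a a' b c c' d => by simpa only [FourCycle.rotate, mul_comm] using h.2 b c c' d a a',
    fun a b b' c d d' => by simpa only [FourCycle.rotate, mul_comm] using h.1 b b' c d d' a⟩

lemma IsMarkov.reflect {P : Table} (h : IsMarkov P) : IsMarkov (reflect P) :=
  ⟨fun a a' b c c' d => by
      simp only [FourCycle.reflect]; linarith [h.2 b a a' d c c'],
    fun a b b' c d d' => by
      simp only [FourCycle.reflect]; linarith [h.1 b b' a d d' c]⟩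

lemma IsMarkov.shift {P : Table} (h : IsMarkov P) (i j k l : Fin 2) :
    IsMarkov (shift P i j k l) :=
  ⟨fun _ _ _ _ _ _ => h.1 _ _ _ _ _ _, fun _ _ _ _ _ _ => h.2 _ _ _ _ _ _⟩

lemma HasLockedEdge.of_rotate {P : Table} (h : HasLockedEdge (rotate P)) : HasLockedEdge P := by
  obtain ⟨e, h | h | h | h⟩ := h <;> refine ⟨e, ?_⟩
  · exact .inr (.inr (.inr fun a b c d hd => h d a b c hd))
  · exact .inl fun a b c d hd => h d a b c hd
  · exact .inr (.inl fun a b c d hd => h d a b c hd)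
  · exact .inr (.inr (.inl fun a b c d hd => h d a b c hd))

lemma HasLockedEdge.of_reflect {P : Table} (h : HasLockedEdge (reflect P)) : HasLockedEdge P := by
  obtain ⟨e, h | h | h | h⟩ := h <;> refine ⟨e, ?_⟩
  · exact .inl fun a b c d hd => h b a d c (by rwa [add_comm])
  · exact .inr (.inr (.inr fun a b c d hd => h b a d c (by rwa [add_comm])))
  · exact .inr (.inr (.inl fun a b c d hd => h b a d c (by rwa [add_comm])))
  · exact .inr (.inl fun a b c d hd => h b a d c (by rwa [add_comm]))

lemma HasLockedEdge.shift {P : Table} (h : HasLockedEdge P) (i j k l : Fin 2) :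
    HasLockedEdge (shift P i j k l) := by
  have key : ∀ e x y s t : Fin 2, x + y = e + (s + t) → x + s + (y + t) = e := by decide
  obtain ⟨e, h | h | h | h⟩ := h
  · exact ⟨e + (i + j), .inl fun a b c d hd => h _ _ _ _ (key _ _ _ _ _ hd)⟩
  · exact ⟨e + (j + k), .inr (.inl fun a b c d hd => h _ _ _ _ (key _ _ _ _ _ hd))⟩
  · exact ⟨e + (k + l), .inr (.inr (.inl fun a b c d hd => h _ _ _ _ (key _ _ _ _ _ hd)))⟩
  · exact ⟨e + (l + i), .inr (.inr (.inr fun a b c d hd => h _ _ _ _ (key _ _ _ _ _ hd)))⟩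

/-- The conclusion of the classification. -/
def Classified (P : Table) : Prop := P ∈ closure model ∨ HasLockedEdge P

lemma Classified.of_rotate {P : Table} (h : Classified (rotate P)) : Classified P := by
  refine h.imp (fun h => ?_) .of_rotate
  have hm : ∀ Q ∈ model, rotate (rotate (rotate Q)) ∈ model := fun Q hQ =>
    rotate_mem_model (rotate_mem_model (rotate_mem_model hQ))
  exact map_mem_closure (continuous_rotate.comp (continuous_rotate.comp continuous_rotate)) h hm

lemma Classified.of_reflect {P : Table} (h : Classified (reflect P)) : Classified P :=
  h.imp (fun h => map_mem_closure continuous_reflect h fun _ => reflect_mem_model) .of_reflect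

lemma Classified.of_shift {P : Table} {i j k l : Fin 2} (h : Classified (shift P i j k l)) :
    Classified P := by
  rw [← shift_shift P i j k l]
  refine Or.imp (fun h => ?_) (fun h => h.shift i j k l) h
  exact map_mem_closure (f := fun P => FourCycle.shift P i j k l) (continuous_shift i j k l) h
    fun _ hQ => shift_mem_model hQ i j k l

/-! ### Degenerations -/

lemma mem_closure_model_of_path (Q : ℝ → Table) (hc : ∀ a b c d, Continuous fun t => Q t a b c d)
    (hQ : ∀ t, 0 < t → Q t ∈ closure model) : Q 0 ∈ closure model := by
  have hcont : Continuous Q := by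
    simp only [continuous_pi_iff]
    exact hc
  have ht : Tendsto Q (𝓝[>] 0) (𝓝 (Q 0)) := hcont.continuousAt.tendsto.mono_left nhdsWithin_le_nhds
  refine isClosed_closure.mem_of_tendsto ht ?_
  filter_upwards [self_mem_nhdsWithin] with t ht using hQ t ht

/-- The table with entries `u c d` at `(0, 0, c, d)`, `v c d` at `(1, 0, c, d)`,
`w c d` at `(0, 1, c, d)` and `z c d` at `(1, 1, c, d)`. -/
def blocks (u v w z : Fin 2 → Fin 2 → ℝ) : Table := fun a b c d =>
  !![u c d, w c d; v c d, z c d] a b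

lemma blocks_mem_model {u : Fin 2 → Fin 2 → ℝ} {r s : Fin 2 → ℝ} {e : ℝ}
    (hu : ∀ c d, 0 < u c d) (hr : ∀ d, 0 < r d) (hs : ∀ c, 0 < s c) (he : 0 < e) :
    blocks u (fun c d => u c d * r d) (fun c d => u c d * s c) (fun c d => u c d * r d * s c * e)
      ∈ model := by
  refine ⟨!![1, 1; 1, e], fun b c => ![1, s c] b, u, fun d a => ![1, r d] a, ?_, ?_, hu, ?_, ?_⟩
  · simp [Fin.forall_fin_two, he]
  · simp [Fin.forall_fin_two, hs]
  · simp [Fin.forall_fin_two, hr]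
  · intro a b c d
    fin_cases a <;> fin_cases b <;> simp [blocks] <;> ring

lemma eq_blocks (P : Table) : P = blocks (P 0 0) (P 1 0) (P 0 1) (P 1 1) := by
  funext a b c d
  fin_cases a <;> fin_cases b <;> rfl

lemma continuous_blocks {u v w z : ℝ → Fin 2 → Fin 2 → ℝ}
    (hu : ∀ c d, Continuous fun t => u t c d) (hv : ∀ c d, Continuous fun t => v t c d)
    (hw : ∀ c d, Continuous fun t => w t c d) (hz : ∀ c d, Continuous fun t => z t c d)
    (a b c d : Fin 2) : Continuous fun t => blocks (u t) (v t) (w t) (z t) a b c d := by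
  fin_cases a <;> fin_cases b
  exacts [hu c d, hw c d, hv c d, hz c d]

lemma mem_closure_model_of_blocks (u v w z : ℝ → Fin 2 → Fin 2 → ℝ)
    (hu : ∀ c d, Continuous fun t => u t c d) (hv : ∀ c d, Continuous fun t => v t c d)
    (hw : ∀ c d, Continuous fun t => w t c d) (hz : ∀ c d, Continuous fun t => z t c d)
    (h : ∀ t, 0 < t → ∃ (r s : Fin 2 → ℝ) (e : ℝ), (∀ c d, 0 < u t c d) ∧ (∀ d, 0 < r d) ∧
      (∀ c, 0 < s c) ∧ 0 < e ∧ (∀ c d, v t c d = u t c d * r d) ∧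
      (∀ c d, w t c d = u t c d * s c) ∧ ∀ c d, z t c d = u t c d * r d * s c * e)
    {P : Table} (hP : P = blocks (u 0) (v 0) (w 0) (z 0)) : P ∈ closure model := by
  rw [hP]
  refine mem_closure_model_of_path (fun t => blocks (u t) (v t) (w t) (z t))
    (continuous_blocks hu hv hw hz) fun t ht => subset_closure ?_
  obtain ⟨r, s, e, hu, hr, hs, he, hv, hw, hz⟩ := h t ht
  have := blocks_mem_model hu hr hs he
  rwa [← funext₂ hv, ← funext₂ hw, ← funext₂ hz] at this

/-- If `X₁ = X₂ = 1` never happens and the odds of `X₁ = 1` and of `X₂ = 1` are finite, the table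
is a limit of the model. -/
lemma mem_closure_model_of_odds {u : Fin 2 → Fin 2 → ℝ} {r s : Fin 2 → ℝ}
    (hu : ∀ c d, 0 ≤ u c d) (hr : ∀ d, 0 ≤ r d) (hs : ∀ c, 0 ≤ s c) :
    blocks u (fun c d => u c d * r d) (fun c d => u c d * s c) 0 ∈ closure model := by
  refine mem_closure_model_of_blocks (fun t c d => u c d + t) (fun t c d => (u c d + t) * (r d + t))
    (fun t c d => (u c d + t) * (s c + t))
    (fun t c d => (u c d + t) * (r d + t) * (s c + t) * t) (by fun_prop) (by fun_prop)
    (by fun_prop) (by fun_prop) (fun t ht => ?_) ?_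
  · have h1 := fun c d => add_pos_of_nonneg_of_pos (hu c d) ht
    have h2 := fun d => add_pos_of_nonneg_of_pos (hr d) ht
    have h3 := fun c => add_pos_of_nonneg_of_pos (hs c) ht
    exact ⟨_, _, t, h1, h2, h3, ht, fun _ _ => rfl, fun _ _ => rfl, fun _ _ => rfl⟩
  · simp; rfl

/-- As `mem_closure_model_of_odds`, where the odds of `X₁ = 1` are infinite given `X₄ = 0`. -/
lemma mem_closure_model_of_infinite_odds {u v s : Fin 2 → ℝ} {r : ℝ}
    (hu : ∀ c, 0 ≤ u c) (hv : ∀ c, 0 ≤ v c) (hs : ∀ c, 0 ≤ s c) (hr : 0 ≤ r) :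
    blocks (fun c => ![0, u c]) (fun c => ![v c, u c * r]) (fun c => ![0, u c * s c]) 0
      ∈ closure model := by
  refine mem_closure_model_of_blocks (fun t c => ![t * (v c + t), u c + t])
    (fun t c => ![v c + t, (u c + t) * (r + t)])
    (fun t c => ![t * (v c + t) * (s c + t), (u c + t) * (s c + t)])
    (fun t c => ![(v c + t) * (s c + t) * t, (u c + t) * (r + t) * (s c + t) * t])
    ?_ ?_ ?_ ?_ (fun t ht => ?_) ?_
  iterate 4 exact fun c d => by fin_cases d <;> simp <;> fun_prop
  · have h1 := fun c => add_pos_of_nonneg_of_pos (hu c) ht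
    have h2 := fun c => add_pos_of_nonneg_of_pos (hv c) ht
    have h3 := fun c => add_pos_of_nonneg_of_pos (hs c) ht
    have h4 := add_pos_of_nonneg_of_pos hr ht
    refine ⟨![1 / t, r + t], fun c => s c + t, t, ?_, ?_, h3, ht, ?_, ?_, ?_⟩
    · exact fun c => Fin.forall_fin_two.2 ⟨mul_pos ht (h2 c), h1 c⟩
    · exact Fin.forall_fin_two.2 ⟨one_div_pos.2 ht, h4⟩
    all_goals intro c d; fin_cases d <;> simp <;> field_simp <;> simp
  · congr 1 <;> funext c d <;> fin_cases d <;> simp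

lemma mem_closure_model_of_single_corner_of_pos {u v₀₀ v₀₁ v₁₀ w₀₁ w₁₀ w₁₁ : ℝ} (hu : 0 < u)
    (hv₀₀ : 0 < v₀₀) (hv₀₁ : 0 < v₀₁) (hv₁₀ : 0 < v₁₀) (hw₀₁ : 0 < w₀₁) (hw₁₀ : 0 < w₁₀)
    (hw₁₁ : 0 < w₁₁) :
    blocks !![0, u; 0, 0] !![v₀₀, v₀₁; v₁₀, 0] !![0, w₀₁; w₁₀, w₁₁] 0 ∈ closure model := by
  refine mem_closure_model_of_blocks
    (fun t => !![t * v₀₀, u; t * v₁₀, t * (v₁₀ * w₁₁ / w₁₀)])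
    (fun t => !![v₀₀, v₀₁; v₁₀, t * (v₁₀ * w₁₁ / w₁₀) * (v₀₁ / u)])
    (fun t => !![t * v₀₀ * (w₀₁ / u), w₀₁; w₁₀, w₁₁])
    (fun t => !![v₀₀ * (w₀₁ / u) * t ^ 2, v₀₁ * (w₀₁ / u) * t ^ 2;
      w₁₀ * t, w₁₁ * (v₀₁ / u) * t ^ 2])
    ?_ ?_ ?_ ?_ (fun t ht => ?_) ?_
  iterate 4 exact fun c d => by fin_cases c <;> fin_cases d <;> simp <;> fun_prop
  · refine ⟨![1 / t, v₀₁ / u], ![w₀₁ / u, w₁₀ / (t * v₁₀)], t ^ 2, ?_, ?_, ?_, by positivity,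
      ?_, ?_, ?_⟩
    iterate 3 simp only [Fin.forall_fin_two]; simp; try (constructorm* _ ∧ _ <;> positivity)
    all_goals intro c d; fin_cases c <;> fin_cases d <;> simp <;> field_simp <;> simp
  · congr 1 <;> funext c d <;> fin_cases c <;> fin_cases d <;> simp

/-- As `mem_closure_model_of_odds`, where moreover `P(X₁ = X₂ = 0, X₃ = j, X₄ = k)` vanishes unless
`(j, k) = (0, 1)`. -/
lemma mem_closure_model_of_single_corner {u v₀₀ v₀₁ v₁₀ w₀₁ w₁₀ w₁₁ : ℝ} (hu : 0 < u)
    (hv₀₀ : 0 ≤ v₀₀) (hv₀₁ : 0 ≤ v₀₁) (hv₁₀ : 0 ≤ v₁₀) (hw₀₁ : 0 ≤ w₀₁) (hw₁₀ : 0 ≤ w₁₀)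
    (hw₁₁ : 0 ≤ w₁₁) :
    blocks !![0, u; 0, 0] !![v₀₀, v₀₁; v₁₀, 0] !![0, w₀₁; w₁₀, w₁₁] 0 ∈ closure model := by
  have := mem_closure_model_of_path (fun t => blocks !![0, u; 0, 0]
    !![v₀₀ + t, v₀₁ + t; v₁₀ + t, 0] !![0, w₀₁ + t; w₁₀ + t, w₁₁ + t] 0) ?_ fun t ht =>
      mem_closure_model_of_single_corner_of_pos hu (by positivity) (by positivity) (by positivity)
        (by positivity) (by positivity) (by positivity)
  · simpa using this
  · apply continuous_blocks
    all_goals exact fun c d => by fin_cases c <;> fin_cases d <;> simp <;> fun_prop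

/-- Tables supported where the number of changes along the path `X₂, X₃, X₄, X₁` is minimal given
whether `X₁ = X₂` are limits of the model. -/
lemma mem_closure_model_of_cycle {P : Table} (h0 : ∀ a b c d, 0 ≤ P a b c d)
    (h₁ : P 0 0 0 1 = 0) (h₂ : P 0 0 1 0 = 0) (h₃ : P 0 0 1 1 = 0) (h₄ : P 0 1 0 1 = 0)
    (h₅ : P 1 0 1 0 = 0) (h₆ : P 1 1 0 0 = 0) (h₇ : P 1 1 0 1 = 0) (h₈ : P 1 1 1 0 = 0) :
    P ∈ closure model := by
  set α : ℝ → Fin 2 → Fin 2 → ℝ := fun t => !![P 0 0 0 0 + t, 1; 1, P 1 1 1 1 + t] with hα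
  set β : ℝ → Fin 2 → Fin 2 → ℝ := fun t => !![1, P 1 0 1 1 + t; P 0 1 0 0 + t, 1] with hβ
  set γ : ℝ → Fin 2 → Fin 2 → ℝ := fun t => !![1, P 1 0 0 1 + t; P 0 1 1 0 + t, 1] with hγ
  set δ : ℝ → Fin 2 → Fin 2 → ℝ := fun t => !![1, P 1 0 0 0 + t; P 0 1 1 1 + t, 1] with hδ
  have hpos : ∀ t, 0 < t → ∀ a b c d, 0 < P a b c d + t := fun t ht a b c d =>
    add_pos_of_nonneg_of_pos (h0 a b c d) ht
  let κ : ℝ → Table := fun t a b c d =>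
    if (a = b ∧ b = c ∧ c = d) ∨ (a ≠ b ∧ ((b ≠ c ∧ c = d ∧ d = a) ∨ (b = c ∧ c ≠ d ∧ d = a) ∨
      (b = c ∧ c = d ∧ d ≠ a))) then 1 else t ^ 2
  have key := mem_closure_model_of_path
    (fun t a b c d => κ t a b c d * (α t a b * β t b c * γ t c d * δ t d a)) ?_ fun t ht =>
      subset_closure ?_
  · convert key with a b c d
    fin_cases a <;> fin_cases b <;> fin_cases c <;> fin_cases d <;> simp [κ, *]
  · intro a b c d
    fin_cases a <;> fin_cases b <;> fin_cases c <;> fin_cases d <;> simp [κ, hα, hβ, hγ, hδ] <;>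
      fun_prop
  · refine ⟨fun a b => !![1, 1 / t; 1 / t, 1] a b * α t a b, fun b c => !![1, t; t, 1] b c * β t b c,
      fun c d => !![1, t; t, 1] c d * γ t c d, fun d a => !![1, t; t, 1] d a * δ t d a,
      ?_, ?_, ?_, ?_, ?_⟩
    iterate 4
      have := hpos t ht
      simp [Fin.forall_fin_two, hα, hβ, hγ, hδ, ht, this]
    intro a b c d
    fin_cases a <;> fin_cases b <;> fin_cases c <;> fin_cases d <;> simp [κ] <;> field_simp <;> simp

lemma mem_model_of_pos {P : Table} (hM : IsMarkov P) (h : ∀ a b c d, 0 < P a b c d) :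
    P ∈ model := by
  refine ⟨fun a b => P a b 0 0, fun b c => P 0 b c 0 / P 0 b 0 0,
    fun c d => P 0 0 c d / P 0 0 c 0,
    fun d a => P a 0 0 d * P 0 0 0 0 / (P a 0 0 0 * P 0 0 0 d), fun _ _ => h _ _ _ _,
    fun _ _ => div_pos (h _ _ _ _) (h _ _ _ _), fun _ _ => div_pos (h _ _ _ _) (h _ _ _ _),
    fun _ _ => div_pos (mul_pos (h _ _ _ _) (h _ _ _ _)) (mul_pos (h _ _ _ _) (h _ _ _ _)),
    fun a b c d => ?_⟩
  have hne : ∀ a b c d, P a b c d ≠ 0 := fun a b c d => (h a b c d).ne'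
  have e1 : P a b c d = P a b 0 d * P 0 b c d / P 0 b 0 d := by
    rw [eq_div_iff (hne _ _ _ _)]; linarith [hM.1 a 0 b c 0 d]
  have e2 : P a b 0 d = P a b 0 0 * P a 0 0 d / P a 0 0 0 := by
    rw [eq_div_iff (hne _ _ _ _)]; linarith [hM.2 a b 0 0 d 0]
  have e3 : P 0 b c d = P 0 b c 0 * P 0 0 c d / P 0 0 c 0 := by
    rw [eq_div_iff (hne _ _ _ _)]; linarith [hM.2 0 b 0 c d 0]
  have e4 : P 0 b 0 d = P 0 b 0 0 * P 0 0 0 d / P 0 0 0 0 := by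
    rw [eq_div_iff (hne _ _ _ _)]; linarith [hM.2 0 b 0 0 d 0]
  rw [e1, e2, e3, e4]
  have := hne 0 b 0 0
  have := hne 0 0 c 0
  have := hne 0 0 0 0
  have := hne 0 0 0 d
  have := hne a 0 0 0
  field_simp

/-! ### Classification -/

lemma classified_of_zero_column {P : Table} (h0 : ∀ a b c d, 0 ≤ P a b c d) (hM : IsMarkov P)
    (hz : ∀ c d, P 1 1 c d = 0) (hcol : ∀ c, P 0 0 c 0 = 0) : Classified P := by
  wlog h₁ : P 0 0 1 1 ≠ 0 → P 0 0 0 1 ≠ 0 generalizing P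
  · push Not at h₁
    refine Classified.of_shift (i := 0) (j := 0) (k := 1) (l := 0)
      (this (fun _ _ _ _ => h0 _ _ _ _) (hM.shift _ _ _ _) (fun c d => ?_) (fun c => ?_) ?_)
    · simpa [shift] using hz _ _
    · simpa [shift] using hcol _
    · simp [shift, h₁]
  by_cases h₀ : P 0 0 0 1 = 0
  · have h₁ : P 0 0 1 1 = 0 := by tauto
    refine .inr ⟨0, .inl fun a b c d hab => ?_⟩
    have := hcol c
    have := hz c d
    fin_cases a <;> fin_cases b <;> simp_all
    fin_cases c <;> fin_cases d <;> assumption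
  left
  have hw : ∀ c, P 0 0 c 1 * P 0 1 c 0 = 0 := fun c => by
    rw [← hM.2 0 0 1 c 0 1, hcol, zero_mul]
  have hv := hM.1 0 1 0 0 1 1
  have hpos : 0 < P 0 0 0 1 := (h0 _ _ _ _).lt_of_ne' h₀
  have hw0 := (mul_eq_zero.1 (hw 0)).resolve_left h₀
  by_cases h₂ : P 0 0 1 1 = 0
  · have hv1 : P 1 0 1 1 = 0 := by simpa [h₂, h₀] using hv
    convert mem_closure_model_of_single_corner hpos (h0 1 0 0 0) (h0 1 0 0 1) (h0 1 0 1 0) (h0 0 1 0 1)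
      (h0 0 1 1 0) (h0 0 1 1 1)
    refine (eq_blocks P).trans ?_
    congr 1 <;> funext c d <;> fin_cases c <;> fin_cases d <;> simp [*]
  · have hw1 := (mul_eq_zero.1 (hw 1)).resolve_left h₂
    convert mem_closure_model_of_infinite_odds (u := fun c => P 0 0 c 1) (v := fun c => P 1 0 c 0)
      (s := fun c => P 0 1 c 1 / P 0 0 c 1) (r := P 1 0 0 1 / P 0 0 0 1) (fun c => h0 _ _ _ _)
      (fun c => h0 _ _ _ _) (fun c => div_nonneg (h0 _ _ _ _) (h0 _ _ _ _))
      (div_nonneg (h0 _ _ _ _) (h0 _ _ _ _))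
    refine (eq_blocks P).trans ?_
    congr 1 <;> funext c d <;> fin_cases c <;> fin_cases d <;> simp [*] <;> field_simp
    all_goals linarith

lemma classified_of_zero_cell {P : Table} (h0 : ∀ a b c d, 0 ≤ P a b c d) (hM : IsMarkov P)
    (hz : ∀ c d, P 1 1 c d = 0) : Classified P := by
  have hcol : ∀ {Q : Table}, (∀ a b c d, 0 ≤ Q a b c d) → IsMarkov Q → (∀ c d, Q 1 1 c d = 0) →
      ∀ d, (∀ c, Q 0 0 c d = 0) → Classified Q := by
    intro Q h0 hM hz d hd
    refine Classified.of_shift (i := 0) (j := 0) (k := 0) (l := d)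
      (classified_of_zero_column (fun _ _ _ _ => h0 _ _ _ _) (hM.shift _ _ _ _) (fun c d => ?_)
        fun c => ?_)
    · simpa [shift] using hz _ _
    · simpa [shift] using hd _
  by_cases h₁ : ∃ d, ∀ c, P 0 0 c d = 0
  · obtain ⟨d, hd⟩ := h₁
    exact hcol h0 hM hz d hd
  by_cases h₂ : ∃ c, ∀ d, P 0 0 c d = 0
  · obtain ⟨c, hc⟩ := h₂
    exact .of_reflect (hcol (fun _ _ _ _ => h0 _ _ _ _) hM.reflect (fun _ _ => hz _ _) c hc)
  push Not at h₁ h₂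
  choose f hf using h₁
  choose g hg using h₂
  left
  convert mem_closure_model_of_odds (u := P 0 0) (r := fun d => P 1 0 (f d) d / P 0 0 (f d) d)
    (s := fun c => P 0 1 c (g c) / P 0 0 c (g c)) (h0 0 0)
    (fun _ => div_nonneg (h0 _ _ _ _) (h0 _ _ _ _))
    (fun _ => div_nonneg (h0 _ _ _ _) (h0 _ _ _ _))
  refine (eq_blocks P).trans ?_
  congr 1 <;> funext c d
  · rw [mul_div_assoc', eq_div_iff (hf d)]
    linarith [hM.1 0 1 0 c (f d) d]
  · rw [mul_div_assoc', eq_div_iff (hg c)]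
    linarith [hM.2 0 0 1 c d (g c)]
  · exact hz c d

/-- Every edge marginal is strictly positive. -/
def HasFullEdges (P : Table) : Prop :=
  (∀ a b, ∃ c d, P a b c d ≠ 0) ∧ (∀ b c, ∃ a d, P a b c d ≠ 0) ∧
    (∀ c d, ∃ a b, P a b c d ≠ 0) ∧ ∀ d a, ∃ b c, P a b c d ≠ 0

lemma classified_of_not_hasFullEdges {P : Table} (h0 : ∀ a b c d, 0 ≤ P a b c d)
    (hM : IsMarkov P) (h : ¬ HasFullEdges P) : Classified P := by
  have key : ∀ {Q : Table}, (∀ a b c d, 0 ≤ Q a b c d) → IsMarkov Q → ∀ a b,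
      (∀ c d, Q a b c d = 0) → Classified Q := by
    intro Q h0 hM a b hz
    refine Classified.of_shift (i := 1 + a) (j := 1 + b) (k := 0) (l := 0)
      (classified_of_zero_cell (fun _ _ _ _ => h0 _ _ _ _) (hM.shift _ _ _ _) fun c d => ?_)
    have : ∀ a : Fin 2, 1 + (1 + a) = a := by decide
    simpa [shift, this] using hz c d
  simp only [HasFullEdges, not_and_or] at h
  push Not at h
  obtain ⟨a, b, h⟩ | ⟨b, c, h⟩ | ⟨c, d, h⟩ | ⟨d, a, h⟩ := h
  · exact key h0 hM a b h
  · exact .of_rotate <| .of_rotate <| .of_rotate <|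
      key (fun _ _ _ _ => h0 _ _ _ _) hM.rotate.rotate.rotate b c fun _ _ => h _ _
  · exact .of_rotate <| .of_rotate <|
      key (fun _ _ _ _ => h0 _ _ _ _) hM.rotate.rotate c d fun _ _ => h _ _
  · exact .of_rotate <| key (fun _ _ _ _ => h0 _ _ _ _) hM.rotate d a fun _ _ => h _ _

lemma classified_of_cycle_zeros {P : Table} (h0 : ∀ a b c d, 0 ≤ P a b c d) (hM : IsMarkov P)
    (z₀ : P 0 0 0 0 = 0) (z₁ : P 0 1 0 0 = 0) (z₂ : P 0 0 1 0 = 0) : Classified P := by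
  by_cases hF : HasFullEdges P
  swap
  · exact classified_of_not_hasFullEdges h0 hM hF
  obtain ⟨hab, hbc, hcd, hda⟩ := hF
  replace hab := hab 0 0
  replace hbc := hbc 0 1
  replace hcd := hcd 0 0
  replace hda := hda 0 0
  simp only [Fin.exists_fin_two, z₀, z₁, z₂, ne_eq, not_true_eq_false, or_false, false_or]
    at hab hbc hcd hda
  have z₃ : P 1 1 0 0 = 0 := by simpa [z₁, hda] using hM.1 0 1 1 0 1 0
  have z₄ : P 0 0 1 1 = 0 := by simpa [z₂, hda] using hM.2 0 0 1 1 0 1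
  simp only [z₃, z₄, not_true_eq_false, or_false, false_or] at hab hbc hcd
  have z₅ : P 1 1 0 1 = 0 := by simpa [z₃, hcd] using hM.2 1 0 1 0 0 1
  have z₆ : P 1 0 1 1 = 0 := by simpa [z₄, hab] using hM.1 0 1 0 0 1 1
  simp only [z₆, not_true_eq_false, or_false] at hbc
  have z₇ : P 1 1 1 1 = 0 := by simpa [z₆, hbc] using hM.2 1 0 1 1 0 1
  refine Classified.of_shift (i := 0) (j := 0) (k := 0) (l := 1)
    (.inl (mem_closure_model_of_cycle (fun _ _ _ _ => h0 _ _ _ _) ?_ ?_ ?_ ?_ ?_ ?_ ?_ ?_))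
  all_goals simpa [shift]

lemma classified_of_zero {P : Table} (h0 : ∀ a b c d, 0 ≤ P a b c d) (hM : IsMarkov P)
    (z : P 0 0 0 0 = 0) : Classified P := by
  have h₁ : P 0 0 0 1 = 0 ∨ P 0 1 0 0 = 0 := by simpa [z] using hM.2 0 0 1 0 0 1
  have h₂ : P 0 0 1 0 = 0 ∨ P 1 0 0 0 = 0 := by simpa [z] using hM.1 0 1 0 0 1 0
  obtain h₁ | h₁ := h₁ <;> obtain h₂ | h₂ := h₂
  · exact .of_rotate <| .of_rotate <| .of_rotate <|
      classified_of_cycle_zeros (fun _ _ _ _ => h0 _ _ _ _) hM.rotate.rotate.rotate z h₂ h₁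
  · exact .of_rotate <| .of_rotate <|
      classified_of_cycle_zeros (fun _ _ _ _ => h0 _ _ _ _) hM.rotate.rotate z h₁ h₂
  · exact classified_of_cycle_zeros h0 hM z h₁ h₂
  · exact .of_rotate <| classified_of_cycle_zeros (fun _ _ _ _ => h0 _ _ _ _) hM.rotate z h₂ h₁

lemma IsMarkov.classified {P : Table} (hM : IsMarkov P) (h0 : ∀ a b c d, 0 ≤ P a b c d) :
    Classified P := by
  by_cases hpos : ∀ a b c d, P a b c d ≠ 0
  · exact .inl (subset_closure (mem_model_of_pos hM fun a b c d =>
      (h0 a b c d).lt_of_ne' (hpos a b c d)))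
  push Not at hpos
  obtain ⟨a, b, c, d, z⟩ := hpos
  exact Classified.of_shift (i := a) (j := b) (k := c) (l := d)
    (classified_of_zero (fun _ _ _ _ => h0 _ _ _ _) (hM.shift _ _ _ _) (by simpa [FourCycle.shift] using z))

lemma HasLockedEdge.isMarkov {P : Table} (h : HasLockedEdge P) : IsMarkov P := by
  have key : ∀ {x x' : Fin 2}, x ≠ x' → ∀ y e, x + y = e ∨ x' + y = e := by decide
  have key' : ∀ {x x' : Fin 2}, x ≠ x' → ∀ y e, y + x = e ∨ y + x' = e := by decide
  obtain ⟨e, h⟩ := h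
  refine ⟨fun a a' b c c' d => ?_, fun a b b' c d d' => ?_⟩
  · rcases eq_or_ne a a' with rfl | ha
    · ring
    rcases eq_or_ne c c' with rfl | hc
    · ring
    obtain h | h | h | h := h
    · rcases key ha b e with hb | hb <;> simp [h _ _ _ _ hb]
    · rcases key' hc b e with hb | hb <;> simp [h _ _ _ _ hb]
    · rcases key hc d e with hb | hb <;> simp [h _ _ _ _ hb]
    · rcases key' ha d e with hb | hb <;> simp [h _ _ _ _ hb]
  · rcases eq_or_ne b b' with rfl | hb
    · ring
    rcases eq_or_ne d d' with rfl | hd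
    · ring
    obtain h | h | h | h := h
    · rcases key' hb a e with ha | ha <;> simp [h _ _ _ _ ha]
    · rcases key hb c e with ha | ha <;> simp [h _ _ _ _ ha]
    · rcases key' hd c e with ha | ha <;> simp [h _ _ _ _ ha]
    · rcases key hd a e with ha | ha <;> simp [h _ _ _ _ ha]

lemma isMarkov_of_mem_closure_model {P : Table} (h : P ∈ closure model) : IsMarkov P := by
  have hcl : IsClosed {P : Table | IsMarkov P} := by
    simp only [IsMarkov, Set.ofPred_and, Set.ofPred_forall]
    refine .inter ?_ ?_ <;>
    exact isClosed_iInter fun _ => isClosed_iInter fun _ => isClosed_iInter fun _ =>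
      isClosed_iInter fun _ => isClosed_iInter fun _ => isClosed_iInter fun _ =>
        isClosed_eq (by fun_prop) (by fun_prop)
  refine closure_minimal (fun Q hQ => ?_) hcl h
  obtain ⟨α, β, γ, δ, -, -, -, -, hQ⟩ := hQ
  exact ⟨fun a a' b c c' d => by simp only [hQ]; ring, fun a b b' c d d' => by simp only [hQ]; ring⟩

/-! ### Functions on `Fin 4 → Fin 2` -/

/-- A function on `Fin 4 → Fin 2` as a table. -/
def toTable (p : (Fin 4 → Fin 2) → ℝ) : Table := fun a b c d => p ![a, b, c, d]

lemma eq_vec (x : Fin 4 → Fin 2) : x = ![x 0, x 1, x 2, x 3] := by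
  funext i; fin_cases i <;> rfl

lemma toTable_apply (p : (Fin 4 → Fin 2) → ℝ) (x : Fin 4 → Fin 2) :
    toTable p (x 0) (x 1) (x 2) (x 3) = p x := by
  rw [toTable, ← eq_vec]

lemma isMarkov_toTable_iff (p : (Fin 4 → Fin 2) → ℝ) :
    IsMarkov (toTable p) ↔
    ((∀ x y : Fin 4 → Fin 2, x 1 = y 1 → x 3 = y 3 →
        p x * p y =
          p (Function.update x 2 (y 2)) * p (Function.update y 2 (x 2))) ∧
     (∀ x y : Fin 4 → Fin 2, x 0 = y 0 → x 2 = y 2 →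
        p x * p y =
          p (Function.update x 3 (y 3)) * p (Function.update y 3 (x 3)))) := by
  refine and_congr ⟨fun h x y h₁ h₂ => ?_, fun h a a' b c c' d => ?_⟩
    ⟨fun h x y h₁ h₂ => ?_, fun h a b b' c d d' => ?_⟩
  · have := h (x 0) (y 0) (x 1) (x 2) (y 2) (x 3)
    simp only [← toTable_apply p]
    simpa [h₁, h₂] using this
  · have := h ![a, b, c, d] ![a', b, c', d] rfl rfl
    simp only [← toTable_apply p] at this
    simpa using this
  · have := h (x 0) (x 1) (y 1) (x 2) (x 3) (y 3)
    simp only [← toTable_apply p]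
    simpa [h₁, h₂] using this
  · have := h ![a, b, c, d] ![a, b', c, d'] rfl rfl
    simp only [← toTable_apply p] at this
    simpa using this

lemma hasLockedEdge_toTable_iff (p : (Fin 4 → Fin 2) → ℝ) :
    HasLockedEdge (toTable p) ↔
     (∃ i : Fin 4, ∀ x : Fin 4 → Fin 2, x i ≠ x (i + 1) → p x = 0) ∨
     (∃ i : Fin 4, ∀ x : Fin 4 → Fin 2, x i = x (i + 1) → p x = 0) := by
  have h₀ : ∀ a b : Fin 2, a + b = 0 ↔ a = b := by decide
  have h₁ : ∀ a b : Fin 2, a + b = 1 ↔ a ≠ b := by decide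
  have hall : ∀ Z : Fin 2 → Fin 2 → Fin 2 → Fin 2 → Prop,
      (∀ a b c d, Z a b c d → toTable p a b c d = 0) ↔
        ∀ x : Fin 4 → Fin 2, Z (x 0) (x 1) (x 2) (x 3) → p x = 0 := fun Z =>
    ⟨fun h x hx => toTable_apply p x ▸ h _ _ _ _ hx, fun h a b c d hZ => h ![a, b, c, d] hZ⟩
  simp only [HasLockedEdge, hall fun a b _ _ => a + b = _, hall fun _ b c _ => b + c = _,
    hall fun _ _ c d => c + d = _, hall fun a _ _ d => d + a = _]
  rw [Fin.exists_fin_two, or_comm]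
  simp [h₀, h₁, Fin.exists_fin_succ]

end FourCycle

open FourCycle in
/-- binary random variables `X₁, X₂, X₃, X₄` with joint pmf `p`
satisfy the global Markov statements of the four-cycle `C₄` iff `p` lies in the
closure of the parametric graphical model of `C₄`, or some neighboring pair
satisfies `Xᵢ = Xᵢ₊₁` a.s., or some neighboring pair satisfies `Xᵢ ≠ Xᵢ₊₁` a.s. -/
theorem binary_fourCycle_globalMarkov (p : (Fin 4 → Fin 2) → ℝ)
    (hnonneg : ∀ x, 0 ≤ p x) (hsum : ∑ x, p x = 1) :
    ((∀ x y : Fin 4 → Fin 2, x 1 = y 1 → x 3 = y 3 →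
        p x * p y =
          p (Function.update x 2 (y 2)) * p (Function.update y 2 (x 2))) ∧
     (∀ x y : Fin 4 → Fin 2, x 0 = y 0 → x 2 = y 2 →
        p x * p y =
          p (Function.update x 3 (y 3)) * p (Function.update y 3 (x 3)))) ↔
    (p ∈ closure { q : (Fin 4 → Fin 2) → ℝ |
        ∃ a b c d : Fin 2 → Fin 2 → ℝ,
          (∀ u v, 0 < a u v) ∧ (∀ u v, 0 < b u v) ∧
          (∀ u v, 0 < c u v) ∧ (∀ u v, 0 < d u v) ∧
          (∀ x : Fin 4 → Fin 2,
            q x = a (x 0) (x 1) * b (x 1) (x 2) * c (x 2) (x 3) * d (x 3) (x 0)) ∧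
          ∑ x, q x = 1 } ∨
     (∃ i : Fin 4, ∀ x : Fin 4 → Fin 2, x i ≠ x (i + 1) → p x = 0) ∨
     (∃ i : Fin 4, ∀ x : Fin 4 → Fin 2, x i = x (i + 1) → p x = 0)) := by
  rw [← isMarkov_toTable_iff, ← hasLockedEdge_toTable_iff]
  refine ⟨fun hM => (hM.classified fun _ _ _ _ => hnonneg _).imp (fun h => ?_) id, ?_⟩
  · let f : Table → (Fin 4 → Fin 2) → ℝ := fun Q x => Q (x 0) (x 1) (x 2) (x 3)
    have hp : f (toTable p) = p := funext (toTable_apply p)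
    have hcont : ContinuousAt (fun Q x => f Q x / ∑ y, f Q y) (toTable p) := by
      have hne : ∑ y, f (toTable p) y ≠ 0 := by simp [hp, hsum]
      refine continuousAt_pi.2 fun x => ContinuousAt.div ?_ ?_ hne <;>
        exact Continuous.continuousAt (by fun_prop)
    have hfp : (fun x => f (toTable p) x / ∑ y, f (toTable p) y) = p := by simp [hp, hsum]
    rw [← hfp]
    refine closure_mono ?_ (hcont.continuousWithinAt.mem_closure_image h)
    rintro _ ⟨Q, ⟨a, b, c, d, ha, hb, hc, hd, hQ⟩, rfl⟩
    have hpos : 0 < ∑ y, f Q y := Finset.sum_pos (fun x _ => by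
      have := ha (x 0) (x 1)
      have := hb (x 1) (x 2)
      have := hc (x 2) (x 3)
      have := hd (x 3) (x 0)
      simp only [f, hQ]
      positivity) Finset.univ_nonempty
    refine ⟨fun u v => a u v / ∑ y, f Q y, b, c, d, fun u v => div_pos (ha u v) hpos, hb, hc, hd,
      fun x => ?_, ?_⟩
    · simp only [f, hQ]
      ring
    · rw [← Finset.sum_div, div_self hpos.ne']
  · rintro (h | h)
    · refine isMarkov_of_mem_closure_model (map_mem_closure (f := toTable) ?_ h ?_)
      · unfold toTable
        fun_prop
      · rintro q ⟨a, b, c, d, ha, hb, hc, hd, hq, -⟩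
        exact ⟨a, b, c, d, ha, hb, hc, hd, fun x y z w => hq ![x, y, z, w]⟩
    · exact h.isMarkov
end

section
/- Let $X = (X_1, \ldots, X_m)$ be a random vector on a standard Borel probability space whose distribution is the multivariate Gaussian $\mathcal{N}(\mu, \Sigma)$ with mean $\mu \in \mathbb{R}^m$ and positive definite covariance matrix $\Sigma \in \mathbb{R}^{m \times m}$. Let $A, B, C \subseteq [m]$ be pairwise disjoint. Then $X_A = (X_v)_{v \in A}$ and $X_B = (X_v)_{v \in B}$ are conditionally independent given the $\sigma$-algebra generated by $X_C = (X_v)_{v \in C}$ if and only if the submatrix $\Sigma_{A \cup C,\, B \cup C}$ has rank at most $\#C$. -/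
open MeasureTheory ProbabilityTheory Real Matrix

/-- The multivariate Gaussian measure `N(μ, Σ)` on `ℝ^m` with positive definite
covariance `Σ`, defined via its density
`(2π)^{-m/2} (det Σ)^{-1/2} exp(-½ (x-μ)ᵀ Σ⁻¹ (x-μ))`
with respect to Lebesgue measure. -/
noncomputable def multivariateGaussian {m : ℕ} (μ : Fin m → ℝ)
    (S : Matrix (Fin m) (Fin m) ℝ) : Measure (Fin m → ℝ) :=
  volume.withDensity (fun x =>
    ENNReal.ofReal (Real.sqrt (((2 * π) ^ m * S.det)⁻¹) *
      Real.exp (-(1 / 2) * ((x - μ) ⬝ᵥ S⁻¹.mulVec (x - μ)))))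

namespace Matrix

/-- The rank of a block matrix with nonsingular lower right block `D` is at most the size of `D`
iff the Schur complement of `D` vanishes. -/
lemma rank_fromBlocks_le_card_iff {K l n o : Type*} [Field K] [Fintype l] [Fintype n] [Fintype o]
    [DecidableEq o] (P : Matrix l n K) (Q : Matrix l o K) (R : Matrix o n K) (D : Matrix o o K)
    (hD : D.det ≠ 0) :
    (fromBlocks P Q R D).rank ≤ Fintype.card o ↔ P = Q * D⁻¹ * R := by
  have hu : IsUnit D.det := hD.isUnit
  refine ⟨fun h ↦ ?_, ?_⟩
  · by_contra hne
    obtain ⟨i, j, hij⟩ : ∃ i j, P i j ≠ (Q * D⁻¹ * R) i j := by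
      by_contra! hall
      exact hne (ext hall)
    let := D.invertibleOfIsUnitDet hu
    set N : Matrix (Unit ⊕ o) (Unit ⊕ o) K :=
      (fromBlocks P Q R D).submatrix (Sum.map (fun _ ↦ i) id) (Sum.map (fun _ ↦ j) id) with hN
    have hN' : N = fromBlocks (P.submatrix (fun _ ↦ i) (fun _ ↦ j)) (Q.submatrix (fun _ ↦ i) id)
        (R.submatrix id (fun _ ↦ j)) D := by
      ext a b
      rcases a with a | a <;> rcases b with b | b <;> rfl
    have hdet : N.det ≠ 0 := by
      rw [hN', det_fromBlocks₂₂, invOf_eq_nonsing_inv]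
      refine mul_ne_zero hD ?_
      rw [det_unique, sub_apply, sub_ne_zero]
      exact hij
    have := rank_submatrix_le (fromBlocks P Q R D) (Sum.map (fun _ : Unit ↦ i) id)
      (Sum.map (fun _ : Unit ↦ j) id)
    rw [← hN, rank_of_det_ne_zero hdet, Fintype.card_sum, Fintype.card_unit] at this
    omega
  · rintro rfl
    have : fromBlocks (Q * D⁻¹ * R) Q R D = fromRows (Q * D⁻¹) 1 * fromCols R D := by
      rw [fromRows_mul_fromCols, Matrix.one_mul, Matrix.one_mul,
        nonsing_inv_mul_cancel_right _ _ hu]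
    rw [this]
    exact (rank_mul_le_left _ _).trans (rank_le_card_width _)

end Matrix

namespace ProbabilityTheory

open scoped MatrixOrder

/-- The standard Gaussian measure on `ι → ℝ` as a measure with density. -/
lemma pi_gaussianReal_eq_withDensity (ι : Type*) [Fintype ι] :
    Measure.pi (fun _ : ι ↦ gaussianReal 0 1) =
      volume.withDensity fun x : ι → ℝ ↦ ENNReal.ofReal (∏ i, gaussianPDFReal 0 1 (x i)) := by
  refine Measure.pi_eq fun s hs ↦ ?_
  rw [withDensity_apply _ (MeasurableSet.univ_pi hs), volume_pi, Measure.restrict_pi_pi,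
    ← ofReal_integral_eq_lintegral_ofReal, integral_fintype_prod_eq_prod,
    ENNReal.ofReal_prod_of_nonneg]
  · simp_rw [gaussianReal_apply_eq_integral _ one_ne_zero]
  · exact fun i _ ↦ integral_nonneg (gaussianPDFReal_nonneg _ _)
  · exact Integrable.fintype_prod fun i ↦ (integrable_gaussianPDFReal 0 1).restrict
  · exact .of_forall fun x ↦ Finset.prod_nonneg fun i _ ↦ gaussianPDFReal_nonneg _ _ _

lemma prod_gaussianPDFReal_zero_one {m : ℕ} (x : Fin m → ℝ) :
    ∏ i, gaussianPDFReal 0 1 (x i) =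
      √((2 * π) ^ m)⁻¹ * rexp (-(1 / 2) * (x ⬝ᵥ x)) := by
  simp only [gaussianPDFReal, Finset.prod_mul_distrib, ← Real.exp_sum]
  congr 1
  · simp only [NNReal.coe_one, mul_one, Finset.prod_const, Finset.card_univ, Fintype.card_fin,
      Real.sqrt_inv, inv_pow]
    rw [_root_.inv_inj, eq_comm, Real.sqrt_eq_iff_mul_self_eq (by positivity) (by positivity),
      ← mul_pow, Real.mul_self_sqrt (by positivity)]
  · simp only [dotProduct, Finset.mul_sum]
    congr 1
    refine Finset.sum_congr rfl fun i _ ↦ ?_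
    simp only [sub_zero, NNReal.coe_one]
    ring

/-- The measure with Gaussian density is the image of the standard Gaussian measure under an affine
map whose linear part is the square root of the covariance matrix. -/
lemma map_pi_gaussianReal_eq_multivariateGaussian {m : ℕ} (μ : Fin m → ℝ)
    {S : Matrix (Fin m) (Fin m) ℝ} (hS : S.PosDef) :
    (Measure.pi fun _ : Fin m ↦ gaussianReal 0 1).map (fun z ↦ μ + CFC.sqrt S *ᵥ z) =
      _root_.multivariateGaussian μ S := by
  set M := CFC.sqrt S with hM
  have hMM : M * M = S := CFC.sqrt_mul_sqrt_self S hS.posSemidef.nonneg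
  have hMt : Mᵀ = M := by
    have := (CFC.sqrt_nonneg S).posSemidef.isHermitian
    rwa [IsHermitian, conjTranspose_eq_transpose_of_trivial] at this
  have hdet : M.det ≠ 0 := by
    intro h
    have := hS.det_pos
    rw [← hMM, det_mul, h] at this
    simp at this
  have hquad (z : Fin m → ℝ) : (M *ᵥ z) ⬝ᵥ S⁻¹ *ᵥ (M *ᵥ z) = z ⬝ᵥ z := by
    rw [mulVec_mulVec, dotProduct_comm, dotProduct_mulVec, ← mulVec_transpose, hMt, mulVec_mulVec,
      ← hMM, Matrix.mul_inv_rev, Matrix.mul_assoc, nonsing_inv_mul _ hdet.isUnit, Matrix.mul_one,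
      mul_nonsing_inv _ hdet.isUnit, one_mulVec]
  have hvol : volume.map (fun z ↦ μ + M *ᵥ z) = ENNReal.ofReal |(M.det)⁻¹| • volume := by
    have : (fun z ↦ μ + M *ᵥ z) = (fun x ↦ μ + x) ∘ toLin' M := rfl
    rw [this, ← Measure.map_map (by fun_prop) (by fun_prop),
      Real.map_matrix_volume_pi_eq_smul_volume_pi hdet, Measure.map_smul, map_add_left_eq_self]
  have hmeas : Measurable fun z ↦ μ + M *ᵥ z := by fun_prop
  set φ : (Fin m → ℝ) → ENNReal := fun x ↦ ENNReal.ofReal (√(((2 * π) ^ m * S.det)⁻¹) *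
    rexp (-(1 / 2) * ((x - μ) ⬝ᵥ S⁻¹ *ᵥ (x - μ)))) with hφ
  have hφm : Measurable φ := by fun_prop
  have hdens (z : Fin m → ℝ) : ENNReal.ofReal (∏ i, gaussianPDFReal 0 1 (z i)) =
      ENNReal.ofReal |M.det| * φ (μ + M *ᵥ z) := by
    simp only [hφ, add_sub_cancel_left, hquad]
    rw [← ENNReal.ofReal_mul (abs_nonneg _), prod_gaussianPDFReal_zero_one, ← hMM, det_mul,
      ← mul_assoc, mul_inv, Real.sqrt_mul (by positivity), Real.sqrt_inv (M.det * M.det),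
      Real.sqrt_mul_self_eq_abs]
    congr 2
    have := abs_ne_zero.2 hdet
    field_simp
  ext s hs
  rw [Measure.map_apply hmeas hs, pi_gaussianReal_eq_withDensity,
    withDensity_apply _ (hmeas hs), _root_.multivariateGaussian, withDensity_apply _ hs]
  simp_rw [hdens]
  rw [lintegral_const_mul _ (by exact hφm.comp hmeas), ← setLIntegral_map hs hφm hmeas, hvol,
    Measure.restrict_smul, lintegral_smul_measure, smul_eq_mul, ← mul_assoc,
    ← ENNReal.ofReal_mul (abs_nonneg _), ← abs_mul, mul_inv_cancel₀ hdet, abs_one,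
    ENNReal.ofReal_one, one_mul]

/-- The measure with Gaussian density agrees with Mathlib's multivariate Gaussian measure. -/
lemma map_toLp_multivariateGaussian {m : ℕ} (μ : Fin m → ℝ)
    {S : Matrix (Fin m) (Fin m) ℝ} (hS : S.PosDef) :
    (_root_.multivariateGaussian μ S).map (WithLp.toLp 2) =
      ProbabilityTheory.multivariateGaussian (WithLp.toLp 2 μ) S := by
  rw [← map_pi_gaussianReal_eq_multivariateGaussian μ hS, ProbabilityTheory.multivariateGaussian,
    ← map_pi_eq_stdGaussian, Measure.map_map (by fun_prop) (by fun_prop),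
    Measure.map_map (by fun_prop) (by fun_prop)]
  rfl

section

variable {Ω : Type*} [MeasurableSpace Ω] {P : Measure Ω} {m : ℕ} {μ : Fin m → ℝ}
  {S : Matrix (Fin m) (Fin m) ℝ} {X : Ω → Fin m → ℝ}

lemma hasGaussianLaw_of_map_eq_multivariateGaussian (hS : S.PosDef) (hX : Measurable X)
    (hlaw : P.map X = _root_.multivariateGaussian μ S) : HasGaussianLaw X P := by
  have : HasGaussianLaw (WithLp.toLp 2 ∘ X) P := ⟨by
    rw [← Measure.map_map (by fun_prop) hX, hlaw, map_toLp_multivariateGaussian μ hS]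
    infer_instance⟩
  exact this.map_equiv (PiLp.continuousLinearEquiv 2 ℝ fun _ ↦ ℝ)

lemma covariance_eval_of_map_eq_multivariateGaussian (hS : S.PosDef) (hX : Measurable X)
    (hlaw : P.map X = _root_.multivariateGaussian μ S) (i j : Fin m) :
    cov[fun ω ↦ X ω i, fun ω ↦ X ω j; P] = S i j := by
  have hm : P.map (WithLp.toLp 2 ∘ X) =
      ProbabilityTheory.multivariateGaussian (WithLp.toLp 2 μ) S := by
    rw [← Measure.map_map (by fun_prop) hX, hlaw, map_toLp_multivariateGaussian μ hS]
  rw [← covariance_eval_multivariateGaussian (μ := WithLp.toLp 2 μ) hS.posSemidef i j, ← hm,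
    covariance_map (by fun_prop) (by fun_prop) (by fun_prop)]
  rfl

end

section

variable {Ω β γ β' γ' : Type*} {m' mΩ : MeasurableSpace Ω} {hm' : m' ≤ mΩ}
  {P : Measure Ω} [IsProbabilityMeasure P] {mβ : MeasurableSpace β} {mγ : MeasurableSpace γ}
  {mβ' : MeasurableSpace β'} {mγ' : MeasurableSpace γ'}

lemma condExp_indicator_inter_ae_eq {s t : Set Ω} (hs : MeasurableSet s)
    (ht : MeasurableSet[m'] t) : P⟦s ∩ t | m'⟧ =ᵐ[P] t.indicator (P⟦s | m'⟧) := by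
  rw [Set.inter_comm, ← Set.indicator_indicator]
  exact condExp_indicator ((integrable_const _).indicator hs) ht

/-- Conditional independence given `m'` is preserved when both variables are paired with
`m'`-measurable ones. -/
lemma CondIndepFun.prodMk_of_measurable [StandardBorelSpace Ω] {F : Ω → β} {G : Ω → γ} {Z : Ω → β'}
    {W : Ω → γ'} (h : CondIndepFun m' hm' F G P) (hF : Measurable F) (hG : Measurable G)
    (hZ : Measurable[m'] Z) (hW : Measurable[m'] W) :
    CondIndepFun m' hm' (fun ω ↦ (F ω, Z ω)) (fun ω ↦ (G ω, W ω)) P := by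
  have hZ' : Measurable Z := hZ.mono hm' le_rfl
  have hW' : Measurable W := hW.mono hm' le_rfl
  rw [condIndepFun_iff_condExp_inter_preimage_eq_mul hF hG] at h
  rw [condIndepFun_iff_condIndep]
  refine CondIndepSets.condIndep (hF.prodMk hZ').comap_le (hG.prodMk hW').comap_le
    (isPiSystem_prod.comap _) (isPiSystem_prod.comap _)
    (by rw [← generateFrom_prod, MeasurableSpace.comap_generateFrom]; rfl)
    (by rw [← generateFrom_prod, MeasurableSpace.comap_generateFrom]; rfl) ?_
  rw [condIndepSets_iff]
  rotate_left
  · rintro _ ⟨_, ⟨u, hu, v, hv, rfl⟩, rfl⟩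
    exact hF.prodMk hZ' (MeasurableSet.prod hu hv)
  · rintro _ ⟨_, ⟨u, hu, v, hv, rfl⟩, rfl⟩
    exact hG.prodMk hW' (MeasurableSet.prod hu hv)
  rintro _ _ ⟨_, ⟨u, hu, v, hv, rfl⟩, rfl⟩ ⟨_, ⟨u', hu', v', hv', rfl⟩, rfl⟩
  simp only [Set.mk_preimage_prod]
  rw [Set.inter_inter_inter_comm]
  filter_upwards [condExp_indicator_inter_ae_eq (P := P) (hF hu) (hZ hv),
    condExp_indicator_inter_ae_eq (P := P) (hG hu') (hW hv'),
    condExp_indicator_inter_ae_eq (P := P) ((hF hu).inter (hG hu')) ((hZ hv).inter (hW hv')),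
    h u u' hu hu'] with ω h₁ h₂ h₃ h₄
  rw [Pi.mul_apply, h₁, h₂, h₃]
  by_cases hz : ω ∈ Z ⁻¹' v
  · by_cases hw : ω ∈ W ⁻¹' v'
    · rw [Set.indicator_of_mem hz, Set.indicator_of_mem hw,
        Set.indicator_of_mem (Set.mem_inter hz hw), h₄]
    · rw [Set.indicator_of_notMem hw, Set.indicator_of_notMem fun h ↦ hw h.2, mul_zero]
  · rw [Set.indicator_of_notMem hz, Set.indicator_of_notMem fun h ↦ hz h.1, zero_mul]

/-- Conditioning on a variable independent of the pair `(F, G)` does not affect independence. -/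
lemma condIndepFun_comap_iff_indepFun [StandardBorelSpace Ω] {F : Ω → β}
    {G : Ω → γ} {Z : Ω → β'} (hF : Measurable F) (hG : Measurable G)
    (hZ : MeasurableSpace.comap Z mβ' ≤ mΩ) (h : IndepFun (fun ω ↦ (F ω, G ω)) Z P) :
    CondIndepFun (MeasurableSpace.comap Z mβ') hZ F G P ↔ IndepFun F G P := by
  have hconst (s : Set (β × γ)) (hs : MeasurableSet s) :
      P⟦(fun ω ↦ (F ω, G ω)) ⁻¹' s | MeasurableSpace.comap Z mβ'⟧ =ᵐ[P]
        fun _ ↦ P.real ((fun ω ↦ (F ω, G ω)) ⁻¹' s) := by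
    refine (condExp_indep_eq (hF.prodMk hG).comap_le hZ ?_ h).trans ?_
    · exact stronglyMeasurable_const.indicator ⟨s, hs, rfl⟩
    · rw [integral_indicator_const _ (hF.prodMk hG hs)]
      simp
  rw [condIndepFun_iff_condExp_inter_preimage_eq_mul hF hG,
    indepFun_iff_measure_inter_preimage_eq_mul]
  refine forall₂_congr fun u v ↦ forall₂_congr fun hu hv ↦ ?_
  have h₁ := hconst (u ×ˢ v) (hu.prod hv)
  have h₂ := hconst (u ×ˢ Set.univ) (hu.prod .univ)
  have h₃ := hconst (Set.univ ×ˢ v) (MeasurableSet.univ.prod hv)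
  simp only [Set.mk_preimage_prod, Set.preimage_univ, Set.inter_univ, Set.univ_inter] at h₁ h₂ h₃
  have key : P (F ⁻¹' u ∩ G ⁻¹' v) = P (F ⁻¹' u) * P (G ⁻¹' v) ↔
      P.real (F ⁻¹' u ∩ G ⁻¹' v) = P.real (F ⁻¹' u) * P.real (G ⁻¹' v) := by
    simp only [measureReal_def, ← ENNReal.toReal_mul]
    rw [ENNReal.toReal_eq_toReal_iff' (by finiteness) (by finiteness)]
  rw [key]
  constructor
  · intro h
    obtain ⟨ω, h, h₁, h₂, h₃⟩ := (h.and (h₁.and (h₂.and h₃))).exists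
    simpa only [h₁, h₂, h₃] using h
  · intro h
    filter_upwards [h₁, h₂, h₃] with ω h₁ h₂ h₃
    rwa [h₁, h₂, h₃]

end

section

variable {Ω ι κ o : Type*} {mΩ : MeasurableSpace Ω} {P : Measure Ω} [IsProbabilityMeasure P]
  [Fintype o] {F : Ω → ι → ℝ} {G : Ω → κ → ℝ} {Z : Ω → o → ℝ}

lemma _root_.Measurable.sub_mulVec {α : Type*} {mα : MeasurableSpace α} {H : α → ι → ℝ}
    {V : α → o → ℝ} (hH : Measurable H) (K : Matrix ι o ℝ) (hV : Measurable V) :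
    Measurable fun a ↦ H a - K *ᵥ V a := by
  refine measurable_pi_lambda _ fun i ↦ ?_
  simp only [Pi.sub_apply, mulVec, dotProduct]
  fun_prop

/-- Conditional independence given `Z` is preserved by subtracting linear functions of `Z`. -/
lemma CondIndepFun.sub_mulVec [StandardBorelSpace Ω]
    {hZ : MeasurableSpace.comap Z inferInstance ≤ mΩ}
    (h : CondIndepFun (MeasurableSpace.comap Z inferInstance) hZ F G P)
    (hF : Measurable F) (hG : Measurable G) (K : Matrix ι o ℝ) (K' : Matrix κ o ℝ) :
    CondIndepFun (MeasurableSpace.comap Z inferInstance) hZ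
      (fun ω ↦ F ω - K *ᵥ Z ω) (fun ω ↦ G ω - K' *ᵥ Z ω) P :=
  (h.prodMk_of_measurable hF hG (comap_measurable Z) (comap_measurable Z)).comp
    (measurable_fst.sub_mulVec K measurable_snd) (measurable_fst.sub_mulVec K' measurable_snd)

lemma condIndepFun_sub_mulVec_iff [StandardBorelSpace Ω]
    (hZ : MeasurableSpace.comap Z inferInstance ≤ mΩ)
    (hF : Measurable F) (hG : Measurable G) (K : Matrix ι o ℝ) (K' : Matrix κ o ℝ) :
    CondIndepFun (MeasurableSpace.comap Z inferInstance) hZ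
      (fun ω ↦ F ω - K *ᵥ Z ω) (fun ω ↦ G ω - K' *ᵥ Z ω) P ↔
    CondIndepFun (MeasurableSpace.comap Z inferInstance) hZ F G P := by
  have hZm : Measurable Z := measurable_iff_comap_le.2 hZ
  refine ⟨fun h ↦ ?_, fun h ↦ h.sub_mulVec hF hG K K'⟩
  simpa [neg_mulVec] using h.sub_mulVec (hF.sub_mulVec K hZm) (hG.sub_mulVec K' hZm) (-K) (-K')

lemma covariance_sub_mulVec_left (hF : ∀ i, MemLp (fun ω ↦ F ω i) 2 P)
    (hZ : ∀ c, MemLp (fun ω ↦ Z ω c) 2 P) (K : Matrix ι o ℝ) (i : ι) {V : Ω → ℝ}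
    (hV : MemLp V 2 P) :
    cov[fun ω ↦ (F ω - K *ᵥ Z ω) i, V; P] =
      cov[fun ω ↦ F ω i, V; P] - ∑ c, K i c * cov[fun ω ↦ Z ω c, V; P] := by
  simp only [Pi.sub_apply, mulVec, dotProduct]
  rw [covariance_fun_sub_left (hF i) (memLp_finsetSum _ fun c _ ↦ (hZ c).const_mul _) hV,
    covariance_fun_sum_left (fun c ↦ (hZ c).const_mul _) hV]
  simp only [covariance_const_mul_left]

/-- The residual of regressing `F` on `Z` is uncorrelated with `Z`. -/
lemma covariance_sub_mulVec_eq_zero [DecidableEq o] (hF : ∀ i, MemLp (fun ω ↦ F ω i) 2 P)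
    (hZ : ∀ c, MemLp (fun ω ↦ Z ω c) 2 P) {Q : Matrix ι o ℝ} {D : Matrix o o ℝ} (hD : D.det ≠ 0)
    (hQ : ∀ i c, cov[fun ω ↦ F ω i, fun ω ↦ Z ω c; P] = Q i c)
    (hDcov : ∀ c d, cov[fun ω ↦ Z ω c, fun ω ↦ Z ω d; P] = D c d) (i : ι) (c : o) :
    cov[fun ω ↦ (F ω - (Q * D⁻¹) *ᵥ Z ω) i, fun ω ↦ Z ω c; P] = 0 := by
  rw [covariance_sub_mulVec_left hF hZ _ _ (hZ c)]
  simp only [hQ, hDcov, ← mul_apply]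
  rw [nonsing_inv_mul_cancel_right _ _ hD.isUnit, sub_self]

/-- If `(F, G, Z)` is jointly Gaussian and `Z` has nonsingular covariance matrix, then `F` and `G`
are conditionally independent given `Z` iff their conditional covariance matrix vanishes. -/
lemma HasGaussianLaw.condIndepFun_comap_iff [StandardBorelSpace Ω] [Fintype ι] [Fintype κ]
    [DecidableEq o] (h : HasGaussianLaw (fun ω ↦ (F ω, G ω, Z ω)) P)
    (hF : Measurable F) (hG : Measurable G) (hZ : MeasurableSpace.comap Z inferInstance ≤ mΩ)
    {M : Matrix ι κ ℝ} {Q : Matrix ι o ℝ} {R : Matrix o κ ℝ} {D : Matrix o o ℝ}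
    (hM : ∀ i j, cov[fun ω ↦ F ω i, fun ω ↦ G ω j; P] = M i j)
    (hQ : ∀ i c, cov[fun ω ↦ F ω i, fun ω ↦ Z ω c; P] = Q i c)
    (hR : ∀ c j, cov[fun ω ↦ Z ω c, fun ω ↦ G ω j; P] = R c j)
    (hDcov : ∀ c d, cov[fun ω ↦ Z ω c, fun ω ↦ Z ω d; P] = D c d) (hD : D.det ≠ 0) :
    CondIndepFun (MeasurableSpace.comap Z inferInstance) hZ F G P ↔ M = Q * D⁻¹ * R := by
  have hF₂ (i) : MemLp (fun ω ↦ F ω i) 2 P := (h.fst.eval i).memLp_two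
  have hG₂ (j) : MemLp (fun ω ↦ G ω j) 2 P := (h.snd.fst.eval j).memLp_two
  have hZ₂ (c) : MemLp (fun ω ↦ Z ω c) 2 P := (h.snd.snd.eval c).memLp_two
  have hZm : Measurable Z := measurable_iff_comap_le.2 hZ
  have hR' (j c) : cov[fun ω ↦ G ω j, fun ω ↦ Z ω c; P] = Rᵀ j c := by
    rw [covariance_comm, hR, transpose_apply]
  set U : Ω → ι → ℝ := fun ω ↦ F ω - (Q * D⁻¹) *ᵥ Z ω
  set W : Ω → κ → ℝ := fun ω ↦ G ω - (Rᵀ * D⁻¹) *ᵥ Z ω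
  have hUZ := covariance_sub_mulVec_eq_zero hF₂ hZ₂ hD hQ hDcov
  have hWZ := covariance_sub_mulVec_eq_zero hG₂ hZ₂ hD hR' hDcov
  have hjoint : HasGaussianLaw (fun ω ↦ (Sum.elim (U ω) (W ω), Z ω)) P := by
    let L : ((ι → ℝ) × (κ → ℝ) × (o → ℝ)) →ₗ[ℝ] ((ι ⊕ κ → ℝ) × (o → ℝ)) :=
      { toFun p := (Sum.elim (p.1 - (Q * D⁻¹) *ᵥ p.2.2) (p.2.1 - (Rᵀ * D⁻¹) *ᵥ p.2.2), p.2.2)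
        map_add' p q := by
          ext s
          · rcases s with i | i <;> simp [mulVec_add] <;> ring
          · rfl
        map_smul' a p := by
          ext s
          · rcases s with i | i <;> simp [mulVec_smul, mul_sub]
          · rfl }
    exact h.map_fun (LinearMap.toContinuousLinearMap L)
  have hUW : HasGaussianLaw (fun ω ↦ (U ω, W ω)) P := by
    let L : (ι ⊕ κ → ℝ) →ₗ[ℝ] (ι → ℝ) × (κ → ℝ) :=
      (LinearMap.funLeft ℝ ℝ Sum.inl).prod (LinearMap.funLeft ℝ ℝ Sum.inr)
    exact hjoint.fst.map_fun (LinearMap.toContinuousLinearMap L)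
  have hU₂ (i) : MemLp (fun ω ↦ U ω i) 2 P := (hUW.fst.eval i).memLp_two
  have hW₂ (j) : MemLp (fun ω ↦ W ω j) 2 P := (hUW.snd.eval j).memLp_two
  have hind : IndepFun (fun ω ↦ (U ω, W ω)) Z P := by
    have := HasGaussianLaw.indepFun_of_covariance_eval (P := P)
      (X := fun s ω ↦ Sum.elim (U ω) (W ω) s) (Y := fun c ω ↦ Z ω c) hjoint (by
        rintro (i | j) c
        · exact hUZ i c
        · exact hWZ j c)
    exact this.comp (φ := fun v : ι ⊕ κ → ℝ ↦ (fun i ↦ v (.inl i), fun j ↦ v (.inr j))) (ψ := id)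
      (by fun_prop) measurable_id
  have hcov (i j) : cov[fun ω ↦ U ω i, fun ω ↦ W ω j; P] = M i j - (Q * D⁻¹ * R) i j := by
    have hZU (c) : cov[fun ω ↦ Z ω c, fun ω ↦ U ω i; P] = 0 := by
      rw [covariance_comm]
      exact hUZ i c
    rw [covariance_comm, covariance_sub_mulVec_left hG₂ hZ₂ _ _ (hU₂ i)]
    simp only [hZU, mul_zero, Finset.sum_const_zero, sub_zero]
    rw [covariance_comm, covariance_sub_mulVec_left hF₂ hZ₂ _ _ (hG₂ j)]
    simp only [hM, hR, mul_apply]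
  rw [← condIndepFun_sub_mulVec_iff hZ hF hG (Q * D⁻¹) (Rᵀ * D⁻¹),
    condIndepFun_comap_iff_indepFun (hF.sub_mulVec _ hZm) (hG.sub_mulVec _ hZm) hZ hind]
  constructor
  · intro hi
    ext i j
    rw [← sub_eq_zero, ← hcov]
    exact (hi.comp (measurable_pi_apply i) (measurable_pi_apply j)).covariance_eq_zero
      (hU₂ i) (hW₂ j)
  · intro hMeq
    exact HasGaussianLaw.indepFun_of_covariance_eval (X := fun i ω ↦ U ω i)
      (Y := fun j ω ↦ W ω j) hUW fun i j ↦ by rw [hcov, hMeq, sub_self]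

end

end ProbabilityTheory

/-- for a random vector `X` with nonsingular Gaussian distribution
`N(μ, Σ)` and pairwise disjoint `A, B, C ⊆ [m]`, the subvectors `X_A` and `X_B`
are conditionally independent given `σ(X_C)` iff `Σ_{A∪C, B∪C}` has rank at
most `#C`. -/
theorem gaussian_condIndepFun_iff_rank_le {Ω : Type*} [mΩ : MeasurableSpace Ω]
    [StandardBorelSpace Ω] (μpr : Measure Ω) [IsProbabilityMeasure μpr]
    (m : ℕ) (μ : Fin m → ℝ) (S : Matrix (Fin m) (Fin m) ℝ) (hS : S.PosDef)
    (X : Ω → (Fin m → ℝ)) (hX : Measurable X)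
    (hlaw : Measure.map X μpr = multivariateGaussian μ S)
    (A B C : Finset (Fin m))
    (hAB : Disjoint A B) (hAC : Disjoint A C) (hBC : Disjoint B C)
    (hle : MeasurableSpace.comap (fun ω (v : C) => X ω v) inferInstance ≤ mΩ) :
    CondIndepFun (MeasurableSpace.comap (fun ω (v : C) => X ω v) inferInstance) hle
      (fun ω (v : A) => X ω v) (fun ω (v : B) => X ω v) μpr ↔
    (S.submatrix (fun i : (A ∪ C : Finset (Fin m)) => (i : Fin m))
        (fun j : (B ∪ C : Finset (Fin m)) => (j : Fin m))).rank ≤ C.card := by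
  have hcov := covariance_eval_of_map_eq_multivariateGaussian hS hX hlaw
  have hD : (S.submatrix (Subtype.val : C → Fin m) Subtype.val).det ≠ 0 :=
    (hS.submatrix Subtype.val_injective).det_pos.ne'
  have hjoint : HasGaussianLaw
      (fun ω ↦ (fun v : A ↦ X ω v, fun v : B ↦ X ω v, fun v : C ↦ X ω v)) μpr := by
    let L (T : Finset (Fin m)) : (Fin m → ℝ) →ₗ[ℝ] (T → ℝ) := LinearMap.funLeft ℝ ℝ Subtype.val
    exact (hasGaussianLaw_of_map_eq_multivariateGaussian hS hX hlaw).map_fun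
      (LinearMap.toContinuousLinearMap ((L A).prod ((L B).prod (L C))))
  rw [hjoint.condIndepFun_comap_iff (by fun_prop) (by fun_prop) hle
    (M := S.submatrix Subtype.val Subtype.val) (Q := S.submatrix Subtype.val Subtype.val)
    (R := S.submatrix Subtype.val Subtype.val) (D := S.submatrix Subtype.val Subtype.val)
    (fun _ _ ↦ hcov _ _) (fun _ _ ↦ hcov _ _) (fun _ _ ↦ hcov _ _) (fun _ _ ↦ hcov _ _) hD,
    ← rank_fromBlocks_le_card_iff _ _ _ _ hD, Fintype.card_coe,
    ← rank_submatrix _ (Equiv.Finset.union A C hAC) (Equiv.Finset.union B C hBC)]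
  congr! 2
  ext (i | i) (j | j) <;> rfl
end
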